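/- arXiv:2111.06733 — 10 statements merged into one kernel-verified Lean document; each statement's English description precedes it below -/
import Mathlib

section
/- If there exists an assignment S with load L(S) ≤ C, then the configuration LP (GS) with target C has a feasible solution (x, s). Moreover, if in addition (λ, μ) is an optimal solution to the dual (GS-D) with target C, then λ_j > 0 for all j ∈ J. (Lemma 1.) -/
open Finset
open scoped Classical

/-- Feasibility for the configuration LP (GS) with target `C`:
`x (S, j) ≥ 0` for nonempty `S` (with `x ∅ j = 0`, as the LP only has variables for
nonempty sets), `s ≥ 0`, `∑_{S ≠ ∅} (2 - 1/(C g_j(S))) x(S,j) ≥ 1` for all `j`, and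
`∑_j ∑_{S ∋ i} x(S,j)/g_j(S) + s_i ≤ C` for all `i`. -/
def GSFeasible {M J : Type} [Fintype M] [Fintype J] (g : J → Finset M → ℝ) (C : ℝ)
    (x : Finset M → J → ℝ) (s : M → ℝ) : Prop :=
  (∀ (S : Finset M) (j : J), 0 ≤ x S j) ∧ (∀ j : J, x ∅ j = 0) ∧ (∀ i : M, 0 ≤ s i) ∧
  (∀ j : J, 1 ≤ ∑ S ∈ Finset.univ.filter (fun S : Finset M => S.Nonempty),
      (2 - (C * g j S)⁻¹) * x S j) ∧
  (∀ i : M,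
    (∑ j : J, ∑ S ∈ Finset.univ.filter (fun S : Finset M => i ∈ S), x S j / g j S) + s i ≤ C)

/-- Feasibility for the dual LP (GS-D) with target `C`:
`λ_j ≥ 0`, `μ_i ≥ 1`, and `(2 g_j(S) - 1/C) λ_j - ∑_{i ∈ S} μ_i ≤ 0` for all `j` and
nonempty `S`. -/
def GSDFeasible {M J : Type} [Fintype M] [Fintype J] (g : J → Finset M → ℝ) (C : ℝ)
    (lam : J → ℝ) (mu : M → ℝ) : Prop :=
  (∀ j : J, 0 ≤ lam j) ∧ (∀ i : M, 1 ≤ mu i) ∧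
  (∀ (j : J) (S : Finset M), S.Nonempty → (2 * g j S - C⁻¹) * lam j - ∑ i ∈ S, mu i ≤ 0)

/-- Objective of (GS-D): `-∑_j λ_j + C ∑_i μ_i`. -/
noncomputable def GSDObj {M J : Type} [Fintype M] [Fintype J] (C : ℝ)
    (lam : J → ℝ) (mu : M → ℝ) : ℝ :=
  -(∑ j : J, lam j) + C * ∑ i : M, mu i

/-- The load of an assignment. -/
noncomputable def load {M J : Type} [Fintype M] [Fintype J] [Nonempty M]
    (g : J → Finset M → ℝ) (S : J → Finset M) : ℝ :=
  Finset.univ.sup' Finset.univ_nonempty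
    (fun i => ∑ j ∈ Finset.univ.filter (fun j => i ∈ S j), (g j (S j))⁻¹)

/-- Lemma 1: if there is an assignment of load at most `C`, then (GS) is feasible;
moreover every optimal solution of (GS-D) has `λ_j > 0` for all `j`. -/
theorem lemma1_LP_feasibility (M J : Type) [Fintype M] [Fintype J] [Nonempty M]
    (g : J → Finset M → ℝ)
    (hg0 : ∀ j, g j ∅ = 0)
    (hgpos : ∀ j (S : Finset M), S.Nonempty → 0 < g j S)
    (C : ℝ) (hC : 0 < C)
    (S : J → Finset M) (hSne : ∀ j, (S j).Nonempty) (hload : load g S ≤ C) :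
    (∃ (x : Finset M → J → ℝ) (s : M → ℝ), GSFeasible g C x s) ∧
      ∀ (lam : J → ℝ) (mu : M → ℝ), GSDFeasible g C lam mu →
        (∀ (lam' : J → ℝ) (mu' : M → ℝ), GSDFeasible g C lam' mu' →
          GSDObj C lam mu ≤ GSDObj C lam' mu') →
        ∀ j : J, 0 < lam j := by
  have hl : ∀ i, ∑ j ∈ Finset.univ.filter (fun j => i ∈ S j), (g j (S j))⁻¹ ≤ C := by
    intro i
    refine le_trans ?_ hload
    exact Finset.le_sup' (fun i => ∑ j ∈ Finset.univ.filter (fun j => i ∈ S j), (g j (S j))⁻¹)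
      (Finset.mem_univ i)
  constructor
  · refine ⟨fun T j => if T = S j then 1 else 0, fun _ => 0, ?_, ?_, ?_, ?_, ?_⟩
    · intro T j
      dsimp only
      split_ifs <;> norm_num
    · intro j
      exact if_neg (fun h => (hSne j).ne_empty h.symm)
    · intro i
      exact le_rfl
    · intro j
      have hp := hgpos j (S j) (hSne j)
      obtain ⟨i, hi⟩ := hSne j
      have h1 : (g j (S j))⁻¹ ≤ C := by
        refine le_trans ?_ (hl i)
        refine Finset.single_le_sum (f := fun j => (g j (S j))⁻¹) ?_ ?_
        · intro k _
          exact (inv_pos.mpr (hgpos k (S k) (hSne k))).le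
        · simp [hi]
      have h2 : 1 ≤ C * g j (S j) := by
        have := mul_le_mul_of_nonneg_right h1 hp.le
        rwa [inv_mul_cancel₀ hp.ne'] at this
      have h3 : (C * g j (S j))⁻¹ ≤ 1 := inv_le_one_of_one_le₀ h2
      simp only [mul_ite, mul_one, mul_zero, Finset.sum_ite_eq', Finset.mem_filter,
        Finset.mem_univ, true_and, hSne j, if_true]
      linarith
    · intro i
      refine le_trans (le_of_eq ?_) (hl i)
      rw [add_zero, Finset.sum_filter]
      refine Finset.sum_congr rfl fun j _ => ?_
      simp only [ite_div, zero_div, Finset.sum_ite_eq', Finset.mem_filter,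
        Finset.mem_univ, true_and, one_div]
  · rintro lam mu ⟨hlam, hmu, hc⟩ hopt j
    by_contra hj
    have hj0 : lam j = 0 := le_antisymm (not_lt.mp hj) (hlam j)
    set A : ℝ := 1 + ∑ T : Finset M, 2 * |g j T| with hA
    have hs : ∀ T : Finset M, 2 * |g j T| ≤ ∑ T : Finset M, 2 * |g j T| := fun T =>
      Finset.single_le_sum (f := fun T => 2 * |g j T|) (fun U _ => by positivity)
        (Finset.mem_univ T)
    have hApos : 0 < A := by
      have : 0 ≤ ∑ T : Finset M, 2 * |g j T| := Finset.sum_nonneg fun U _ => by positivity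
      linarith
    have hAi : 0 < A⁻¹ := inv_pos.mpr hApos
    have hCi : 0 < C⁻¹ := inv_pos.mpr hC
    have hfeas : GSDFeasible g C (Function.update lam j A⁻¹) mu := by
      refine ⟨?_, hmu, ?_⟩
      · intro k
        by_cases hk : k = j
        · subst hk
          simpa using hApos.le
        · simpa [Function.update_of_ne hk] using hlam k
      · intro k T hT
        by_cases hk : k = j
        · subst hk
          rw [Function.update_self]
          obtain ⟨i, hi⟩ := hT
          have h1 : 1 ≤ ∑ i ∈ T, mu i :=
            le_trans (hmu i) (Finset.single_le_sum (f := mu)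
              (fun m _ => le_trans zero_le_one (hmu m)) hi)
          have h2 : 2 * g k T - C⁻¹ ≤ A := by
            have := hs T
            have := le_abs_self (g k T)
            linarith
          have h3 := mul_le_mul_of_nonneg_right h2 hAi.le
          rw [mul_inv_cancel₀ hApos.ne'] at h3
          linarith
        · rw [Function.update_of_ne hk]
          exact hc k T hT
    have h := hopt _ _ hfeas
    unfold GSDObj at h
    have hlt : ∑ k, lam k < ∑ k, Function.update lam j A⁻¹ k := by
      refine Finset.sum_lt_sum (fun k _ => ?_) ⟨j, Finset.mem_univ j, ?_⟩
      · by_cases hk : k = j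
        · subst hk
          rw [Function.update_self, hj0]
          exact hAi.le
        · rw [Function.update_of_ne hk]
      · rw [Function.update_self, hj0]
        exact hAi
    linarith
end

section
/- Let (x, s) be a feasible solution to (GS) and (λ, μ) a feasible solution to (GS-D) for target C > 0 whose objective values coincide (i.e., Σ_{i∈M} s_i = −Σ_{j∈J} λ_j + C·Σ_{i∈M} μ_i), and suppose λ_j > 0 for all j ∈ J. Then for every j ∈ J and S ⊆ M with x(S,j) > 0: g_j(S) ≥ 1/(2C), and S maximizes g*_j over all subsets of M, i.e., 2·g_j(S) − Σ_{i∈S} μ_i/λ_j ≥ 2·g_j(S') − Σ_{i∈S'} μ_i/λ_j for all S' ⊆ M. (Lemma 2.) -/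
open Finset
open scoped Classical

/-- Lemma 2 (complementary slackness): if `(x,s)` is feasible for (GS), `(λ,μ)` is
feasible for (GS-D), their objective values coincide, and `λ_j > 0` for all `j`, then
whenever `x(S,j) > 0` we have `g_j(S) ≥ 1/(2C)` and `S` maximizes
`g*_j(S') = 2 g_j(S') - ∑_{i ∈ S'} μ_i / λ_j` over all `S' ⊆ M`. -/
theorem lemma2_comp_slackness (M J : Type) [Fintype M] [Fintype J]
    (g : J → Finset M → ℝ)
    (hg0 : ∀ j, g j ∅ = 0)
    (hgpos : ∀ j (S : Finset M), S.Nonempty → 0 < g j S)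
    (C : ℝ) (hC : 0 < C)
    (x : Finset M → J → ℝ) (s : M → ℝ) (lam : J → ℝ) (mu : M → ℝ)
    (hx : GSFeasible g C x s) (hd : GSDFeasible g C lam mu)
    (hobj : ∑ i : M, s i = GSDObj C lam mu)
    (hlam : ∀ j : J, 0 < lam j) :
    ∀ (j : J) (S : Finset M), 0 < x S j →
      (2 * C)⁻¹ ≤ g j S ∧
        ∀ S' : Finset M,
          2 * g j S' - ∑ i ∈ S', mu i / lam j ≤ 2 * g j S - ∑ i ∈ S, mu i / lam j := by
  obtain ⟨hx0, hxe, hs0, hcov, hcap⟩ := hx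
  obtain ⟨-, hmu, hdual⟩ := hd
  -- reduced-cost terms of the duality gap
  have hDeq : ∀ (j : J) (S : Finset M),
      x S j / g j S * (∑ i ∈ S, mu i) - lam j * ((2 - (C * g j S)⁻¹) * x S j)
        = x S j / g j S * ((∑ i ∈ S, mu i) - (2 * g j S - C⁻¹) * lam j) := by
    intro j S
    rcases S.eq_empty_or_nonempty with rfl | hS
    · simp [hxe]
    · have := (hgpos j S hS).ne'
      field_simp
  have hDnn : ∀ (j : J) (S : Finset M),
      0 ≤ x S j / g j S * ((∑ i ∈ S, mu i) - (2 * g j S - C⁻¹) * lam j) := by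
    intro j S
    rcases S.eq_empty_or_nonempty with rfl | hS
    · simp [hxe]
    · have h1 := hgpos j S hS
      have h2 := hdual j S hS
      exact mul_nonneg (div_nonneg (hx0 S j) h1.le) (by linarith)
  have hcov' : ∀ j : J, 1 ≤ ∑ S : Finset M, (2 - (C * g j S)⁻¹) * x S j := by
    intro j
    refine (hcov j).trans (le_of_eq ?_)
    apply Finset.sum_subset (Finset.subset_univ _)
    intro S _ hS
    have : S = ∅ := by simpa [Finset.not_nonempty_iff_eq_empty] using hS
    simp [this, hxe]
  have hA : ∑ j : J, lam j ≤ ∑ j : J, ∑ S : Finset M, lam j * ((2 - (C * g j S)⁻¹) * x S j) := by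
    apply Finset.sum_le_sum
    intro j _
    rw [← Finset.mul_sum]
    nlinarith [hcov' j, hlam j]
  have hB : ∑ i : M, mu i *
      (∑ j : J, ∑ S ∈ Finset.univ.filter (fun S : Finset M => i ∈ S), x S j / g j S)
        ≤ C * (∑ i : M, mu i) - ∑ i : M, s i := by
    rw [Finset.mul_sum, ← Finset.sum_sub_distrib]
    apply Finset.sum_le_sum
    intro i _
    have h1 := mul_le_mul_of_nonneg_left (hcap i) (zero_le_one.trans (hmu i))
    have h2 := mul_le_mul_of_nonneg_right (hmu i) (hs0 i)
    linarith
  have hswap : ∑ i : M, mu i *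
      (∑ j : J, ∑ S ∈ Finset.univ.filter (fun S : Finset M => i ∈ S), x S j / g j S)
        = ∑ j : J, ∑ S : Finset M, x S j / g j S * (∑ i ∈ S, mu i) := by
    simp_rw [Finset.mul_sum, Finset.sum_filter]
    rw [Finset.sum_comm]
    apply Finset.sum_congr rfl
    intro j _
    rw [Finset.sum_comm]
    apply Finset.sum_congr rfl
    intro S _
    rw [← Finset.sum_filter]
    have : Finset.univ.filter (fun i : M => i ∈ S) = S := by ext; simp
    rw [this]
    exact Finset.sum_congr rfl fun i _ => mul_comm _ _
  have hsum : ∑ j : J, ∑ S : Finset M,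
      x S j / g j S * ((∑ i ∈ S, mu i) - (2 * g j S - C⁻¹) * lam j) ≤ 0 := by
    simp_rw [← hDeq, Finset.sum_sub_distrib]
    rw [← hswap]
    unfold GSDObj at hobj
    linarith
  intro j S hxS
  have hS : S.Nonempty := by
    rw [Finset.nonempty_iff_ne_empty]
    rintro rfl
    simp [hxe] at hxS
  have hgS := hgpos j S hS
  have hle : x S j / g j S * ((∑ i ∈ S, mu i) - (2 * g j S - C⁻¹) * lam j) ≤ 0 := by
    refine le_trans ?_ hsum
    refine le_trans ?_ (Finset.single_le_sum
      (f := fun j => ∑ S : Finset M,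
        x S j / g j S * ((∑ i ∈ S, mu i) - (2 * g j S - C⁻¹) * lam j))
      (fun j _ => Finset.sum_nonneg fun S _ => hDnn j S) (Finset.mem_univ j))
    exact Finset.single_le_sum
      (f := fun S => x S j / g j S * ((∑ i ∈ S, mu i) - (2 * g j S - C⁻¹) * lam j))
      (fun S _ => hDnn j S) (Finset.mem_univ S)
  have hle' : (∑ i ∈ S, mu i) ≤ (2 * g j S - C⁻¹) * lam j := by
    have := nonpos_of_mul_nonpos_right hle (div_pos hxS hgS)
    linarith
  have hl := hlam j
  have hmuS : 0 ≤ ∑ i ∈ S, mu i :=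
    Finset.sum_nonneg fun i _ => zero_le_one.trans (hmu i)
  have h2g : C⁻¹ ≤ 2 * g j S := by
    have := nonneg_of_mul_nonneg_left (hmuS.trans hle') hl
    linarith
  have hlow : C⁻¹ ≤ 2 * g j S - ∑ i ∈ S, mu i / lam j := by
    rw [← Finset.sum_div]
    have := (div_le_iff₀ hl).2 hle'
    linarith
  refine ⟨?_, fun S' => le_trans ?_ hlow⟩
  · rw [mul_inv]
    linarith
  · rcases S'.eq_empty_or_nonempty with rfl | hS'
    · simpa [hg0] using hC.le
    · rw [← Finset.sum_div]
      have h := hdual j S' hS'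
      have := (le_div_iff₀ hl).2 (show (2 * g j S' - C⁻¹) * lam j ≤ ∑ i ∈ S', mu i by linarith)
      linarith
end

section
/- Let M be a finite set, let g : 2^M → ℝ be M♮-concave, and let w : M → ℝ. Define D := argmax_{S⊆M} (2·g(S) − Σ_{i∈S} w_i) and F := {S ⊆ M : S ⊆ T for some T ∈ D}. Then F is a matroid on M, i.e., F is nonempty, downward closed, and for every S, T ∈ F with |S| < |T| there exists i ∈ T∖S with S ∪ {i} ∈ F. (Lemma 3, with w_i playing the role of μ_i/λ_j.) -/
open Finset

/-- `g` is M♮-concave. -/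
def MnatConcave {M : Type} [Fintype M] (g : Finset M → ℝ) : Prop :=
  ∀ p' p'' : M → ℝ, (∀ i, p' i ≤ p'' i) →
    ∀ S' : Finset M, (∀ T : Finset M, g T - ∑ i ∈ T, p' i ≤ g S' - ∑ i ∈ S', p' i) →
      ∃ S'' : Finset M, (∀ T : Finset M, g T - ∑ i ∈ T, p'' i ≤ g S'' - ∑ i ∈ S'', p'' i) ∧
        ∀ i ∈ S', p' i = p'' i → i ∈ S''

/-- The set of maximizers of `S ↦ 2 g(S) - ∑_{i ∈ S} w_i`. -/
def argmaxD {M : Type} [Fintype M] (g : Finset M → ℝ) (w : M → ℝ) : Set (Finset M) :=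
  {S : Finset M | ∀ T : Finset M, 2 * g T - ∑ i ∈ T, w i ≤ 2 * g S - ∑ i ∈ S, w i}

/-- The downward closure `F` of the maximizers of `2 g - w`. -/
def downClosure {M : Type} [Fintype M] (g : Finset M → ℝ) (w : M → ℝ) : Set (Finset M) :=
  {S : Finset M | ∃ T ∈ argmaxD g w, S ⊆ T}

/-- A positive gap separates the maximizers from all other sets. -/
lemma argmaxD_gap {M : Type} [Fintype M] (g : Finset M → ℝ) (w : M → ℝ) :
    ∃ γ : ℝ, 0 < γ ∧ ∀ A ∈ argmaxD g w, ∀ U, U ∉ argmaxD g w →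
      2 * g U - ∑ i ∈ U, w i + γ ≤ 2 * g A - ∑ i ∈ A, w i := by
  classical
  obtain ⟨A₀, -, hA₀⟩ := Finset.exists_max_image (Finset.univ : Finset (Finset M))
    (fun S => 2 * g S - ∑ i ∈ S, w i) ⟨∅, Finset.mem_univ _⟩
  by_cases hne : (Finset.univ.filter (fun U : Finset M => U ∉ argmaxD g w)).Nonempty
  · obtain ⟨U₀, hU₀, hmax⟩ := Finset.exists_max_image _ (fun S => 2 * g S - ∑ i ∈ S, w i) hne
    have hU₀' : U₀ ∉ argmaxD g w := (Finset.mem_filter.1 hU₀).2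
    have hlt : 2 * g U₀ - ∑ i ∈ U₀, w i < 2 * g A₀ - ∑ i ∈ A₀, w i := by
      by_contra hcon
      push Not at hcon
      exact hU₀' (fun T => (hA₀ T (Finset.mem_univ _)).trans hcon)
    refine ⟨_, sub_pos.2 hlt, fun A hA U hU => ?_⟩
    have h1 := hmax U (Finset.mem_filter.2 ⟨Finset.mem_univ _, hU⟩)
    have h2 := hA A₀
    linarith
  · refine ⟨1, one_pos, fun A _ U hU => ?_⟩
    exact absurd ⟨U, Finset.mem_filter.2 ⟨Finset.mem_univ _, hU⟩⟩ hne

lemma sum_price {M : Type} [DecidableEq M] (w : M → ℝ) (ε α : ℝ) (X : Finset M)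
    (a b : M) (T : Finset M) :
    ∑ i ∈ T, (w i / 2 - ε * ((if i ∈ X then 2 else 0) + (if i = a then α else 0)
      + (if i = b then 1 else 0))) =
    (∑ i ∈ T, w i) / 2 - ε * (2 * ((T ∩ X).card : ℝ) + (if a ∈ T then α else 0)
      + (if b ∈ T then 1 else 0)) := by
  rw [Finset.sum_sub_distrib, ← Finset.sum_div, ← Finset.mul_sum, Finset.sum_add_distrib,
    Finset.sum_add_distrib, Finset.sum_ite_eq', Finset.sum_ite_eq', Finset.sum_ite_mem]
  simp [mul_comm]

/-- Local submodularity of the rank function. -/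
lemma key_local {M : Type} [Fintype M] [DecidableEq M] (g : Finset M → ℝ) (hg : MnatConcave g)
    (w : M → ℝ) (X : Finset M) (a b : M) (hab : a ≠ b) (r : ℕ)
    (h0 : ∀ A ∈ argmaxD g w, (A ∩ X).card ≤ r)
    (ha : ∀ A ∈ argmaxD g w, a ∈ A → (A ∩ X).card + 1 ≤ r)
    (hb : ∀ A ∈ argmaxD g w, b ∈ A → (A ∩ X).card + 1 ≤ r)
    (C : Finset M) (hC : C ∈ argmaxD g w) (hCr : r ≤ (C ∩ X).card)
    (A : Finset M) (hA : A ∈ argmaxD g w) (haA : a ∈ A) (hbA : b ∈ A)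
    (hAr : r ≤ (A ∩ X).card + 1) : False := by
  obtain ⟨γ, hγ, hgap⟩ := argmaxD_gap g w
  obtain ⟨ε, hε, hεγ⟩ : ∃ ε : ℝ, 0 < ε ∧ 2 * (ε * (2 * (Fintype.card M : ℝ) + 2)) < γ := by
    have hn : (0 : ℝ) ≤ Fintype.card M := Nat.cast_nonneg _
    refine ⟨γ / (4 * (2 * (Fintype.card M : ℝ) + 2)), by positivity, ?_⟩
    have : 2 * (γ / (4 * (2 * (Fintype.card M : ℝ) + 2)) * (2 * (Fintype.card M : ℝ) + 2))
        = γ / 2 := by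
      field_simp
      norm_num
    rw [this]
    linarith
  have hcard : ∀ U : Finset M, ((U ∩ X).card : ℝ) ≤ Fintype.card M := fun U => by
    exact_mod_cast Finset.card_le_univ _
  have hq : ∀ α : ℝ, 0 ≤ α → α ≤ 1 → ∀ U : Finset M,
      0 ≤ ε * (2 * ((U ∩ X).card : ℝ) + (if a ∈ U then α else 0) + (if b ∈ U then 1 else 0)) ∧
      ε * (2 * ((U ∩ X).card : ℝ) + (if a ∈ U then α else 0) + (if b ∈ U then 1 else 0))
        ≤ ε * (2 * (Fintype.card M : ℝ) + 2) := by
    intro α h1 h2 U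
    have := hcard U
    have h3 : (0 : ℝ) ≤ ((U ∩ X).card : ℝ) := Nat.cast_nonneg _
    constructor
    · apply mul_nonneg hε.le
      split_ifs <;> linarith
    · apply mul_le_mul_of_nonneg_left _ hε.le
      split_ifs <;> linarith
  obtain ⟨S, hS, hSsub⟩ := hg
    (fun i => w i / 2 - ε * ((if i ∈ X then 2 else 0) + (if i = a then 1 else 0)
      + (if i = b then 1 else 0)))
    (fun i => w i / 2 - ε * ((if i ∈ X then 2 else 0) + (if i = a then 0 else 0)
      + (if i = b then 1 else 0)))
    (fun i => by
      apply sub_le_sub_left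
      apply mul_le_mul_of_nonneg_left _ hε.le
      split_ifs <;> norm_num) A (fun U => by
      rw [sum_price, sum_price]
      by_cases hU : U ∈ argmaxD g w
      · have e1 := hA U
        have e2 : ε * (2 * ((U ∩ X).card : ℝ) + (if a ∈ U then 1 else 0)
            + (if b ∈ U then 1 else 0)) ≤ ε * (2 * ((A ∩ X).card : ℝ) + (if a ∈ A then 1 else 0)
            + (if b ∈ A then 1 else 0)) := by
          apply mul_le_mul_of_nonneg_left _ hε.le
          rw [if_pos haA, if_pos hbA]
          have k0 : ((U ∩ X).card : ℝ) ≤ r := by exact_mod_cast h0 U hU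
          have kA : (r : ℝ) ≤ (A ∩ X).card + 1 := by exact_mod_cast hAr
          have ka : a ∈ U → ((U ∩ X).card : ℝ) + 1 ≤ r := fun h => by exact_mod_cast ha U hU h
          have kb : b ∈ U → ((U ∩ X).card : ℝ) + 1 ≤ r := fun h => by exact_mod_cast hb U hU h
          split_ifs with i1 i2 i2
          · linarith [ka i1]
          · linarith [ka i1]
          · linarith [kb i2]
          · linarith
        linarith
      · have e1 := hgap A hA U hU
        have e2 := (hq 1 zero_le_one le_rfl U).2
        have e3 := (hq 1 zero_le_one le_rfl A).1
        linarith)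
  have hbS : b ∈ S := hSsub b hbA (by simp [hab.symm])
  have hSC := hS C
  rw [sum_price, sum_price] at hSC
  have hSD : S ∈ argmaxD g w := by
    by_contra hcon
    have e1 := hgap C hC S hcon
    have e2 := (hq 0 le_rfl zero_le_one S).2
    have e3 := (hq 0 le_rfl zero_le_one C).1
    linarith
  have e1 := hC S
  have e2 : ε * (2 * ((C ∩ X).card : ℝ) + (if a ∈ C then 0 else 0) + (if b ∈ C then 1 else 0)) ≤
      ε * (2 * ((S ∩ X).card : ℝ) + (if a ∈ S then 0 else 0) + (if b ∈ S then 1 else 0)) := by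
    linarith
  have e3 := le_of_mul_le_mul_left e2 hε
  have k1 : ((S ∩ X).card : ℝ) + 1 ≤ r := by exact_mod_cast hb S hSD hbS
  have k2 : (r : ℝ) ≤ (C ∩ X).card := by exact_mod_cast hCr
  rw [if_pos hbS] at e3
  simp only [ite_self] at e3
  split_ifs at e3 <;> linarith

/-- If no element of `T \ S` can be added to `S`, the rank of `S ∪ Y` stays `|S|`. -/
lemma mnat_rank_bound {M : Type} [Fintype M] [DecidableEq M] (g : Finset M → ℝ) (hg : MnatConcave g)
    (w : M → ℝ) (S T C : Finset M) (hC : C ∈ argmaxD g w) (hSC : S ⊆ C)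
    (hno : ∀ i ∈ T \ S, insert i S ∉ downClosure g w) :
    ∀ n : ℕ, ∀ Y : Finset M, Y ⊆ T \ S → Y.card = n →
      ∀ A ∈ argmaxD g w, (A ∩ (S ∪ Y)).card ≤ S.card := by
  intro n
  induction n using Nat.strong_induction_on with
  | _ n ih =>
  intro Y hY hYn A hA
  by_cases hY0 : Y = ∅
  · subst hY0
    rw [Finset.union_empty]
    exact Finset.card_le_card Finset.inter_subset_right
  obtain ⟨a, haY⟩ := Finset.nonempty_iff_ne_empty.2 hY0
  by_cases hY1 : Y.erase a = ∅
  · have hYa : Y = {a} := by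
      rw [← Finset.insert_erase haY, hY1]; rfl
    subst hYa
    have haT := hY haY
    have haS : a ∉ S := (Finset.mem_sdiff.1 haT).2
    by_contra hcon
    push Not at hcon
    apply hno a haT
    refine ⟨A, hA, ?_⟩
    have hu : S ∪ {a} = insert a S := by ext; simp [or_comm]
    rw [hu] at hcon
    have := Finset.eq_of_subset_of_card_le
      (Finset.inter_subset_right : A ∩ insert a S ⊆ insert a S)
      (by rw [Finset.card_insert_of_notMem haS]; omega)
    rw [← this]
    exact Finset.inter_subset_left
  obtain ⟨b, hb'⟩ := Finset.nonempty_iff_ne_empty.2 hY1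
  obtain ⟨hba, hbY⟩ := Finset.mem_erase.1 hb'
  have haS : a ∉ S := (Finset.mem_sdiff.1 (hY haY)).2
  have hbS : b ∉ S := (Finset.mem_sdiff.1 (hY hbY)).2
  have hYpos := Finset.card_pos.2 ⟨a, haY⟩
  have iha := ih (Y.erase a).card (by rw [Finset.card_erase_of_mem haY]; omega) (Y.erase a)
    ((Finset.erase_subset _ _).trans hY) rfl
  have ihb := ih (Y.erase b).card (by rw [Finset.card_erase_of_mem hbY]; omega) (Y.erase b)
    ((Finset.erase_subset _ _).trans hY) rfl
  set X := S ∪ (Y.erase a).erase b with hX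
  have haX : a ∉ X := by simp [hX, haS]
  have hbX : b ∉ X := by simp [hX, hbS]
  have eA : S ∪ Y.erase a = insert b X := by
    ext i; simp only [hX, Finset.mem_union, Finset.mem_erase, Finset.mem_insert]; grind
  have eB : S ∪ Y.erase b = insert a X := by
    ext i; simp only [hX, Finset.mem_union, Finset.mem_erase, Finset.mem_insert]; grind
  have eY : S ∪ Y = insert a (insert b X) := by
    ext i; simp only [hX, Finset.mem_union, Finset.mem_erase, Finset.mem_insert]; grind
  rw [eA] at iha
  rw [eB] at ihb
  rw [eY]
  have cardin : ∀ (U Z : Finset M) (c : M), c ∉ Z → c ∈ U →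
      (U ∩ insert c Z).card = (U ∩ Z).card + 1 := by
    intro U Z c hc hcU
    rw [Finset.inter_insert_of_mem hcU, Finset.card_insert_of_notMem (by simp [hc])]
  by_contra hcon
  push Not at hcon
  have haA : a ∈ A := by
    by_contra h
    rw [Finset.inter_insert_of_notMem h] at hcon
    exact absurd (iha A hA) (by omega)
  have hbA : b ∈ A := by
    by_contra h
    rw [Finset.insert_comm, Finset.inter_insert_of_notMem h] at hcon
    exact absurd (ihb A hA) (by omega)
  rw [cardin A _ a (by simp [haX, hba.symm]) haA, cardin A X b hbX hbA] at hcon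
  refine key_local g hg w X a b hba.symm S.card ?_ ?_ ?_ C hC ?_ A hA haA hbA (by omega)
  · intro U hU
    refine (Finset.card_le_card ?_).trans (iha U hU)
    exact Finset.inter_subset_inter_left (Finset.subset_insert _ _)
  · intro U hU h
    rw [← cardin U X a haX h]
    exact ihb U hU
  · intro U hU h
    rw [← cardin U X b hbX h]
    exact iha U hU
  · exact Finset.card_le_card (Finset.subset_inter hSC Finset.subset_union_left)

/-- Lemma 3: if `g` is M♮-concave, then the downward closure of the maximizers of
`S ↦ 2 g(S) - ∑_{i ∈ S} w_i` is a matroid: nonempty, downward closed, and satisfying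
the exchange property. -/
theorem lemma3_matroid_structure (M : Type) [Fintype M] [DecidableEq M]
    (g : Finset M → ℝ) (hg : MnatConcave g) (w : M → ℝ) :
    (downClosure g w).Nonempty ∧
      (∀ S T : Finset M, T ∈ downClosure g w → S ⊆ T → S ∈ downClosure g w) ∧
      (∀ S ∈ downClosure g w, ∀ T ∈ downClosure g w, S.card < T.card →
        ∃ i ∈ T \ S, insert i S ∈ downClosure g w) := by
  refine ⟨?_, ?_, ?_⟩
  · obtain ⟨A₀, -, hA₀⟩ := Finset.exists_max_image (Finset.univ : Finset (Finset M))
      (fun S => 2 * g S - ∑ i ∈ S, w i) ⟨∅, Finset.mem_univ _⟩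
    exact ⟨A₀, A₀, fun T => hA₀ T (Finset.mem_univ _), Finset.Subset.refl _⟩
  · rintro S T ⟨A, hA, hTA⟩ hST
    exact ⟨A, hA, hST.trans hTA⟩
  · rintro S ⟨C, hC, hSC⟩ T ⟨B, hB, hTB⟩ hlt
    by_contra hcon
    push Not at hcon
    have h := mnat_rank_bound g hg w S T C hC hSC hcon _ (T \ S) (Finset.Subset.refl _) rfl B hB
    have h2 : T ⊆ B ∩ (S ∪ T \ S) := by
      intro i hi
      simp [hTB hi, hi]
    have := Finset.card_le_card h2
    omega
end

section
/- Let M be a finite set, let g : 2^M → ℝ be submodular with g(∅) ≥ 0, let w : M → ℝ, and let T ∈ argmax_{S⊆M} (2·g(S) − Σ_{i∈S} w_i). Then for every S ⊆ T we have g(S) ≥ (1/2)·Σ_{i∈S} w_i. (Lemma 4, with w_i playing the role of μ_i/λ_j.) -/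
open Finset

/-- Lemma 4: if `g` is submodular with `g(∅) ≥ 0` and `T` maximizes
`S ↦ 2 g(S) - ∑_{i ∈ S} w_i`, then `g(S) ≥ (1/2) ∑_{i ∈ S} w_i` for every `S ⊆ T`. -/
theorem lemma4_prices_to_speed (M : Type) [Fintype M] [DecidableEq M]
    (g : Finset M → ℝ)
    (hsub : ∀ S T : Finset M, g (S ∪ T) + g (S ∩ T) ≤ g S + g T)
    (h0 : 0 ≤ g ∅)
    (w : M → ℝ) (T : Finset M)
    (hT : ∀ S : Finset M, 2 * g S - ∑ i ∈ S, w i ≤ 2 * g T - ∑ i ∈ T, w i) :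
    ∀ S ⊆ T, (1 / 2) * ∑ i ∈ S, w i ≤ g S := by
  intro S hS
  have h1 := hT (T \ S)
  have h2 := hsub S (T \ S)
  have h3 := Finset.sum_sdiff (f := w) hS
  rw [Finset.union_sdiff_of_subset hS, Finset.inter_sdiff_self] at h2
  linarith
end

section
/- Suppose the configuration LP (GS) with target C > 0 has a feasible solution (x, s). Then there exists a map σ : J_1 → M with σ(j) ∈ M⁺_j for every j ∈ J_1 such that Σ_{j∈J_1 : σ(j)=i} 1/g_j({σ(j)}) ≤ 32C for every machine i ∈ M; in particular, the single-machine assignment S_j := {σ(j)} of the jobs in J_1 has maximum machine load at most 32C. (Existential content of Lemma 5 / Step 1.) -/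
open Finset
open scoped Classical

/-- `M⁺_j`: the machines `i` with `g_j({i}) ≥ 1/(16 C)`. -/
noncomputable def Mplus {M J : Type} [Fintype M] (g : J → Finset M → ℝ) (C : ℝ) (j : J) :
    Finset M :=
  Finset.univ.filter (fun i => 1 / (16 * C) ≤ g j {i})

/-- `J_1`: the jobs `j` with
`∑_{i ∈ M⁺_j} ∑_{S ∋ i} (g_j({i}) / g_j(S)) x(S,j) ≥ 1/16`. -/
noncomputable def J1 {M J : Type} [Fintype M] [Fintype J] (g : J → Finset M → ℝ) (C : ℝ)
    (x : Finset M → J → ℝ) : Finset J :=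
  Finset.univ.filter (fun j =>
    1 / 16 ≤ ∑ i ∈ Mplus g C j, ∑ S ∈ Finset.univ.filter (fun S : Finset M => i ∈ S),
      (g j {i} / g j S) * x S j)


/-- Length of `[0,t] ∩ [k,k+1]`. -/
noncomputable def slotClamp (k : ℕ) (t : ℝ) : ℝ := min 1 (max 0 (t - k))

lemma slotClamp_mono (k : ℕ) {a b : ℝ} (h : a ≤ b) : slotClamp k a ≤ slotClamp k b := by
  unfold slotClamp
  exact min_le_min le_rfl (max_le_max le_rfl (by linarith))

lemma slotClamp_sum (N : ℕ) (t : ℝ) (h0 : 0 ≤ t) :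
    ∑ k ∈ range N, slotClamp k t = min t N := by
  induction N with
  | zero => simp [h0]
  | succ n ih =>
    rw [sum_range_succ, ih]
    unfold slotClamp
    push_cast
    rcases le_total t n with h | h
    · rw [min_eq_left h, max_eq_left (by linarith), min_eq_right (by linarith),
        min_eq_left (by linarith)]; ring
    · rw [min_eq_right h, max_eq_right (by linarith)]
      rcases le_total t (n + 1) with h' | h'
      · rw [min_eq_right (by linarith), min_eq_left h']; ring
      · rw [min_eq_left (by linarith), min_eq_right h']

lemma slot_exists {J : Type*} (p y : J → ℝ) (hp : ∀ j, 0 ≤ p j) (hy : ∀ j, 0 ≤ y j)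
    (s : Finset J) :
    ∃ z : J → ℕ → ℝ, (∀ j k, 0 ≤ z j k) ∧
      (∀ k, ∑ j ∈ s, z j k = slotClamp k (∑ j ∈ s, y j)) ∧
      (∀ N : ℕ, ∑ j ∈ s, y j ≤ N → ∀ j ∈ s, ∑ k ∈ range N, z j k = y j) ∧
      (∀ j ∈ s, ∀ k, 0 < z j (k + 1) → p j ≤ ∑ j' ∈ s, p j' * z j' k) := by
  induction s using Finset.induction_on_max_value (fun j => - p j) with
  | empty => exact ⟨fun _ _ => 0, by simp, by simp [slotClamp], by simp, by simp⟩
  | insert a s has hmax ih =>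
    obtain ⟨z, hz0, hzs, hzy, hzp⟩ := ih
    set Y := ∑ j ∈ s, y j with hY
    have hY0 : 0 ≤ Y := sum_nonneg fun j _ => hy j
    have hne : ∀ j ∈ s, j ≠ a := fun j hj h => has (h ▸ hj)
    let z' : J → ℕ → ℝ := fun j k =>
      if j = a then slotClamp k (y a + Y) - slotClamp k Y else z j k
    have hza : ∀ k, z' a k = slotClamp k (y a + Y) - slotClamp k Y := fun k => by simp [z']
    have hzj : ∀ j ∈ s, ∀ k, z' j k = z j k := fun j hj k => by simp [z', hne j hj]
    have hz0' : ∀ j k, 0 ≤ z' j k := by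
      intro j k
      by_cases h : j = a
      · subst h
        rw [hza]
        have := slotClamp_mono k (show Y ≤ y j + Y by linarith [hy j])
        linarith
      · simp [z', h, hz0]
    have hsum : ∀ k, ∑ j ∈ insert a s, z' j k = slotClamp k (∑ j ∈ insert a s, y j) := by
      intro k
      rw [sum_insert has, sum_insert has, hza, sum_congr rfl fun j hj => hzj j hj k, hzs k]
      ring
    refine ⟨z', hz0', hsum, ?_, ?_⟩
    · intro N hN j hj
      rw [sum_insert has] at hN
      rcases mem_insert.1 hj with rfl | hj
      · simp only [hza]
        rw [sum_sub_distrib, slotClamp_sum _ _ (by linarith [hy j]), slotClamp_sum _ _ hY0,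
          min_eq_left hN, min_eq_left (by linarith [hy j])]
        ring
      · simp only [hzj j hj]
        exact hzy N (by linarith [hy a]) j hj
    · intro j hj k hk
      rcases mem_insert.1 hj with rfl | hj
      · have h1 : (k : ℝ) + 1 < y j + Y := by
          by_contra hcon
          push Not at hcon
          rw [hza] at hk
          unfold slotClamp at hk
          push_cast at hk
          rw [max_eq_left (by linarith), max_eq_left (by linarith [hy j])] at hk
          simp at hk
        have h2 : ∑ j' ∈ insert j s, z' j' k = 1 := by
          rw [hsum, sum_insert has]
          unfold slotClamp
          rw [max_eq_right (by linarith), min_eq_left (by linarith)]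
        calc p j = ∑ j' ∈ insert j s, p j * z' j' k := by rw [← mul_sum, h2, mul_one]
          _ ≤ _ := by
            refine sum_le_sum fun j' hj' => mul_le_mul_of_nonneg_right ?_ (hz0' _ _)
            rcases mem_insert.1 hj' with rfl | hj'
            · exact le_rfl
            · have := hmax j' hj'
              simpa using this
      · rw [hzj j hj] at hk
        refine (hzp j hj k hk).trans ?_
        rw [sum_insert has, sum_congr rfl fun j' hj' => by rw [← hzj j' hj' k]]
        have := mul_nonneg (hp a) (hz0' a k)
        linarith

/-- Shmoys–Tardos rounding. -/
lemma st_rounding {M J : Type*} [Fintype M] [Fintype J] (p y : M → J → ℝ)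
    (hp : ∀ i j, 0 ≤ p i j) (hy : ∀ i j, 0 ≤ y i j) (P T : ℝ) (hP0 : 0 ≤ P)
    (hcov : ∀ j, 1 ≤ ∑ i, y i j) (hload : ∀ i, ∑ j, p i j * y i j ≤ T)
    (hP : ∀ i j, 0 < y i j → p i j ≤ P) :
    ∃ σ : J → M, (∀ j, 0 < y (σ j) j) ∧
      ∀ i, ∑ j ∈ univ.filter (fun j => σ j = i), p i j ≤ P + T := by
  choose z hz0 hzs hzy hzp using fun i => slot_exists (p i) (y i) (hp i) (hy i) univ
  obtain ⟨N, hN⟩ := exists_nat_ge (∑ i, ∑ j, y i j)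
  have hN' : ∀ i, ∑ j, y i j ≤ N := fun i =>
    (single_le_sum (f := fun i => ∑ j, y i j)
      (fun i _ => sum_nonneg fun j _ => hy i j) (mem_univ i)).trans hN
  have hzy' : ∀ i j, ∑ k ∈ range N, z i j k = y i j := fun i j =>
    hzy i N (hN' i) j (mem_univ j)
  let t : J → Finset (M × ℕ) := fun j =>
    (univ ×ˢ range N).filter (fun q => 0 < z q.1 j q.2)
  have ht : ∀ j, ∑ q ∈ t j, z q.1 j q.2 = ∑ i, y i j := by
    intro j
    rw [sum_filter_of_ne (fun q _ h => lt_of_le_of_ne (hz0 _ _ _) (Ne.symm h)), sum_product]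
    exact sum_congr rfl fun i _ => hzy' i j
  have hall : ∀ A : Finset J, A.card ≤ (A.biUnion t).card := by
    intro A
    have h : (A.card : ℝ) ≤ ((A.biUnion t).card : ℝ) := by
      calc (A.card : ℝ) = ∑ j ∈ A, 1 := by simp
        _ ≤ ∑ j ∈ A, ∑ q ∈ A.biUnion t, z q.1 j q.2 := by
          refine sum_le_sum fun j hj => (hcov j).trans ?_
          rw [← ht j]
          exact sum_le_sum_of_subset_of_nonneg (subset_biUnion_of_mem t hj)
            fun q _ _ => hz0 _ _ _
        _ = ∑ q ∈ A.biUnion t, ∑ j ∈ A, z q.1 j q.2 := sum_comm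
        _ ≤ ∑ q ∈ A.biUnion t, 1 := by
          refine sum_le_sum fun q _ => ?_
          calc ∑ j ∈ A, z q.1 j q.2 ≤ ∑ j, z q.1 j q.2 :=
                sum_le_sum_of_subset_of_nonneg (subset_univ _) fun j _ _ => hz0 _ _ _
            _ = _ := hzs q.1 q.2
            _ ≤ 1 := min_le_left _ _
        _ = _ := by simp
    exact_mod_cast h
  obtain ⟨f, hfinj, hf⟩ := (Finset.all_card_le_biUnion_card_iff_exists_injective t).1 hall
  have hf1 : ∀ j, (f j).2 < N ∧ 0 < z (f j).1 j (f j).2 := by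
    intro j
    have := hf j
    simpa [t] using this
  have hpos : ∀ j, 0 < y (f j).1 j := by
    intro j
    rw [← hzy']
    exact (hf1 j).2.trans_le
      (single_le_sum (f := fun k => z (f j).1 j k) (fun k _ => hz0 _ _ _) (mem_range.2 (hf1 j).1))
  refine ⟨fun j => (f j).1, hpos, fun i => ?_⟩
  let b : ℕ → ℝ := fun k => Nat.casesOn k P (fun k => ∑ j', p i j' * z i j' k)
  have hb0 : ∀ k, 0 ≤ b k := by
    intro k
    cases k with
    | zero => exact hP0
    | succ k => exact sum_nonneg fun j _ => mul_nonneg (hp _ _) (hz0 _ _ _)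
  have hinj : Set.InjOn (fun j => (f j).2) (univ.filter (fun j => (f j).1 = i) : Finset J) := by
    intro a ha c hc hac
    simp only [coe_filter, mem_univ, true_and, Set.mem_ofPred_eq] at ha hc
    exact hfinj (Prod.ext (ha.trans hc.symm) hac)
  calc ∑ j ∈ univ.filter (fun j => (f j).1 = i), p i j
      ≤ ∑ j ∈ univ.filter (fun j => (f j).1 = i), b (f j).2 := by
        refine sum_le_sum fun j hj => ?_
        have hji : (f j).1 = i := (mem_filter.1 hj).2
        have h1 := (hf1 j).2
        have h2 := hpos j
        rw [hji] at h1 h2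
        generalize (f j).2 = k at h1
        cases k with
        | zero => exact hP i j h2
        | succ k => exact hzp i j (mem_univ j) k h1
    _ = ∑ k ∈ (univ.filter (fun j => (f j).1 = i)).image (fun j => (f j).2), b k :=
        (sum_image hinj).symm
    _ ≤ ∑ k ∈ range (N + 1), b k := by
        refine sum_le_sum_of_subset_of_nonneg ?_ fun k _ _ => hb0 k
        intro k hk
        obtain ⟨j, _, rfl⟩ := mem_image.1 hk
        exact mem_range.2 ((hf1 j).1.trans (Nat.lt_succ_self N))
    _ = (∑ k ∈ range N, ∑ j', p i j' * z i j' k) + P :=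
        sum_range_succ' b N
    _ = (∑ j', p i j' * y i j') + P := by
        rw [sum_comm]
        simp only [← mul_sum, hzy']
    _ ≤ P + T := by linarith [hload i]

/-- Step 1 (Lemma 5, existential content): given a feasible solution `(x,s)` of (GS),
there is a single-machine assignment `σ` of the jobs in `J_1`, with `σ j ∈ M⁺_j`, whose
maximum machine load is at most `32 C`. -/
theorem step1_single_machine (M J : Type) [Fintype M] [Fintype J]
    (g : J → Finset M → ℝ)
    (hg0 : ∀ j, g j ∅ = 0)
    (hgpos : ∀ j (S : Finset M), S.Nonempty → 0 < g j S)
    (C : ℝ) (hC : 0 < C)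
    (x : Finset M → J → ℝ) (s : M → ℝ) (hfeas : GSFeasible g C x s) :
    ∃ σ : J → M,
      (∀ j ∈ J1 g C x, σ j ∈ Mplus g C j) ∧
      ∀ i : M, ∑ j ∈ (J1 g C x).filter (fun j => σ j = i), (g j {σ j})⁻¹ ≤ 32 * C := by
  obtain ⟨hx0, hxe, hs0, hcov, hload⟩ := hfeas
  let w : M → J → ℝ := fun i j =>
    ∑ S ∈ Finset.univ.filter (fun S : Finset M => i ∈ S), (g j {i} / g j S) * x S j
  have hg1 : ∀ j i, 0 < g j {i} := fun j i => hgpos j {i} (singleton_nonempty i)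
  have hgS : ∀ j (S : Finset M), 0 ≤ g j S := by
    intro j S
    rcases S.eq_empty_or_nonempty with rfl | h
    · rw [hg0]
    · exact (hgpos j S h).le
  have hw0 : ∀ i j, 0 ≤ w i j := fun i j => sum_nonneg fun S _ =>
    mul_nonneg (div_nonneg (hg1 j i).le (hgS j S)) (hx0 S j)
  let y : M → {j // j ∈ J1 g C x} → ℝ := fun i j =>
    if i ∈ Mplus g C j.1 then 16 * w i j.1 else 0
  have hy0 : ∀ i j, 0 ≤ y i j := by
    intro i j
    simp only [y]
    split_ifs
    · linarith [hw0 i j.1]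
    · exact le_rfl
  have hyM : ∀ i j, 0 < y i j → i ∈ Mplus g C j.1 := by
    intro i j h
    by_contra hc
    simp [y, hc] at h
  have key := st_rounding (fun i (j : {j // j ∈ J1 g C x}) => (g j.1 {i})⁻¹) y
    (fun i j => (inv_pos.2 (hg1 j.1 i)).le) hy0 (16 * C) (16 * C) (by linarith) ?_ ?_ ?_
  · obtain ⟨σ, hσ, hl⟩ := key
    have hM : ∀ j : J, Nonempty M := by
      intro j
      by_contra hM
      rw [not_nonempty_iff] at hM
      have h := hcov j
      rw [sum_eq_zero] at h
      · linarith
      · intro S hS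
        obtain ⟨i, _⟩ := (mem_filter.1 hS).2
        exact (hM.false i).elim
    refine ⟨fun j => if h : j ∈ J1 g C x then σ ⟨j, h⟩ else (hM j).some, ?_, ?_⟩
    · intro j hj
      simp only [hj, dif_pos]
      exact hyM _ _ (hσ ⟨j, hj⟩)
    · intro i
      have h := hl i
      rw [sum_filter] at h ⊢
      rw [← sum_coe_sort]
      calc _ = _ := ?_
        _ ≤ _ := h
        _ = _ := by ring
      refine sum_congr rfl fun j _ => ?_
      simp only [j.2, dif_pos, Subtype.coe_eta]
      split_ifs with h
      · rw [h]
      · rfl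
  · intro j
    have h := (mem_filter.1 j.2).2
    simp only [y]
    rw [← sum_filter, filter_mem_eq_inter, univ_inter, ← mul_sum]
    change 1 / 16 ≤ ∑ i ∈ Mplus g C j.1, w i j.1 at h
    linarith
  · intro i
    have hterm : ∀ j, (g j {i})⁻¹ * w i j
        = ∑ S ∈ Finset.univ.filter (fun S : Finset M => i ∈ S), x S j / g j S := by
      intro j
      simp only [w]
      rw [mul_sum]
      refine sum_congr rfl fun S _ => ?_
      have := (hg1 j i).ne'
      rw [div_mul_eq_mul_div, mul_div_assoc, inv_mul_cancel_left₀ this]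
    have hnn : ∀ j, 0 ≤ (g j {i})⁻¹ * w i j := fun j =>
      mul_nonneg (inv_pos.2 (hg1 j i)).le (hw0 i j)
    calc ∑ j : {j // j ∈ J1 g C x}, (g j.1 {i})⁻¹ * y i j
        ≤ ∑ j : {j // j ∈ J1 g C x}, 16 * ((g j.1 {i})⁻¹ * w i j.1) := by
          refine sum_le_sum fun j _ => ?_
          have := hnn j.1
          simp only [y]
          split_ifs
          · linarith
          · linarith
      _ = ∑ j ∈ J1 g C x, 16 * ((g j {i})⁻¹ * w i j) :=
          sum_coe_sort (J1 g C x) (fun j => 16 * ((g j {i})⁻¹ * w i j))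
      _ ≤ ∑ j, 16 * ((g j {i})⁻¹ * w i j) :=
          sum_le_sum_of_subset_of_nonneg (subset_univ _) fun j _ _ => by linarith [hnn j]
      _ ≤ 16 * C := by
          rw [← mul_sum, sum_congr rfl fun j _ => hterm j]
          linarith [hload i, hs0 i]
  · intro i j h
    have h1 := (mem_filter.1 (hyM i j h)).2
    have h2 : 0 < 1 / (16 * C) := by positivity
    have h3 := inv_anti₀ h2 h1
    simpa using h3
end

section
/- Let (x, s) be a feasible solution to the configuration LP (GS) with target C > 0. Define y_{ij} := 16·Σ_{S⊆M : i∈S} (g_j({i})/g_j(S))·x(S,j) for j ∈ J_1 and i ∈ M⁺_j, and y_{ij} := 0 for i ∈ M∖M⁺_j. Then y ≥ 0 satisfies Σ_{i∈M⁺_j} y_{ij} ≥ 1 for every j ∈ J_1 and Σ_{j∈J_1} y_{ij}/g_j({i}) ≤ 16C for every i ∈ M; that is, y is a feasible solution to the assignment LP (GS-A). (Feasibility of (GS-A), proved in the appendix.) -/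
open Finset
open scoped Classical

/-- Feasibility of (GS-A): given a feasible solution `(x,s)` of (GS), the vector
`y_{ij} := 16 ∑_{S ∋ i} (g_j({i})/g_j(S)) x(S,j)` for `j ∈ J_1`, `i ∈ M⁺_j` (and
`y_{ij} := 0` otherwise) is nonnegative, satisfies `∑_{i ∈ M⁺_j} y_{ij} ≥ 1` for every
`j ∈ J_1`, and `∑_{j ∈ J_1} y_{ij} / g_j({i}) ≤ 16 C` for every `i ∈ M`. -/
theorem GSA_feasibility (M J : Type) [Fintype M] [Fintype J]
    (g : J → Finset M → ℝ)
    (hg0 : ∀ j, g j ∅ = 0)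
    (hgpos : ∀ j (S : Finset M), S.Nonempty → 0 < g j S)
    (C : ℝ) (hC : 0 < C)
    (x : Finset M → J → ℝ) (s : M → ℝ) (hfeas : GSFeasible g C x s)
    (y : M → J → ℝ)
    (hy_def : ∀ (i : M), ∀ j ∈ J1 g C x, i ∈ Mplus g C j →
      y i j = 16 * ∑ S ∈ Finset.univ.filter (fun S : Finset M => i ∈ S),
        (g j {i} / g j S) * x S j)
    (hy_zero : ∀ (i : M), ∀ j ∈ J1 g C x, i ∉ Mplus g C j → y i j = 0) :
    (∀ (i : M), ∀ j ∈ J1 g C x, 0 ≤ y i j) ∧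
      (∀ j ∈ J1 g C x, 1 ≤ ∑ i ∈ Mplus g C j, y i j) ∧
      (∀ i : M, ∑ j ∈ J1 g C x, y i j / g j {i} ≤ 16 * C) := by
  obtain ⟨hx, -, hs, -, hload⟩ := hfeas
  have hg : ∀ j (S : Finset M), 0 ≤ g j S := by
    intro j S
    rcases S.eq_empty_or_nonempty with h | h
    · rw [h, hg0]
    · exact (hgpos j S h).le
  refine ⟨?_, ?_, ?_⟩
  · intro i j hj
    by_cases hi : i ∈ Mplus g C j
    · rw [hy_def i j hj hi]
      exact mul_nonneg (by norm_num) (Finset.sum_nonneg fun S _ =>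
        mul_nonneg (div_nonneg (hg _ _) (hg _ _)) (hx _ _))
    · rw [hy_zero i j hj hi]
  · intro j hj
    rw [Finset.sum_congr rfl (fun i hi => hy_def i j hj hi), ← Finset.mul_sum]
    have h := (Finset.mem_filter.mp hj).2
    linarith
  · intro i
    have hnn : ∀ j, 0 ≤ ∑ S ∈ Finset.univ.filter (fun S : Finset M => i ∈ S),
        x S j / g j S := fun j =>
      Finset.sum_nonneg fun S _ => div_nonneg (hx _ _) (hg _ _)
    have h1 : ∀ j ∈ J1 g C x, y i j / g j {i} ≤
        16 * ∑ S ∈ Finset.univ.filter (fun S : Finset M => i ∈ S), x S j / g j S := by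
      intro j hj
      by_cases hi : i ∈ Mplus g C j
      · have hp : 0 < g j {i} := hgpos j {i} (Finset.singleton_nonempty i)
        rw [hy_def i j hj hi, div_le_iff₀ hp, mul_assoc, Finset.sum_mul]
        refine le_of_eq (congrArg _ (Finset.sum_congr rfl fun S _ => ?_))
        ring
      · rw [hy_zero i j hj hi, zero_div]
        exact mul_nonneg (by norm_num) (hnn j)
    have h2 := Finset.sum_le_sum h1
    rw [← Finset.mul_sum] at h2
    have h3 := Finset.sum_le_sum_of_subset_of_nonneg (Finset.subset_univ (J1 g C x))
      (fun j _ _ => hnn j)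
    have h4 := hload i
    have h5 := hs i
    linarith
end

section
/- Let every processing speed function g_j be M♮-concave, let (x, s) and (λ, μ) be optimal solutions to (GS) and (GS-D) for target C > 0 (feasible solutions with coinciding objective values, and λ_j > 0 for all j). Then there exists a family (S_j)_{j∈J_2} of nonempty subsets of M such that g_j(S_j) ≥ 1/(2C) for every j ∈ J_2 and every machine i ∈ M belongs to at most 20 of the sets S_j; in particular, the assignment (S_j)_{j∈J_2} of the jobs in J_2 has maximum machine load at most 40C. (Existential content of Lemma 6 / Step 2.) -/
open Finset
open scoped Classical

/-- `J_2`: the jobs `j ∉ J_1` with `∑_{S ∈ S²_j} x(S,j) ≥ 1/8`, where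
`S²_j = {S ⊆ M : ∑_{i ∈ S} μ_i / λ_j ≤ 4/C}`. -/
noncomputable def J2 {M J : Type} [Fintype M] [Fintype J] (g : J → Finset M → ℝ) (C : ℝ)
    (x : Finset M → J → ℝ) (lam : J → ℝ) (mu : M → ℝ) : Finset J :=
  (Finset.univ \ J1 g C x).filter (fun j =>
    1 / 8 ≤ ∑ S ∈ Finset.univ.filter (fun S : Finset M => ∑ i ∈ S, mu i / lam j ≤ 4 / C),
      x S j)

/-- Invariants of the auction state `(H, q)`: `H i` holders of machine `i`, `q j i` price levels. -/
structure AucInv {M K : Type} [Fintype M] [Fintype K] (g : K → Finset M → ℝ) (p : K → M → ℝ)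
    (b : ℕ) (ε : ℝ) (B : ℕ) (H : M → Finset K) (q : K → M → ℕ) : Prop where
  dem : ∀ j, ∃ D : Finset M, (∀ i, j ∈ H i → i ∈ D) ∧
    ∀ T : Finset M, g j T - ∑ i ∈ T, (p j i + ε * q j i) ≤ g j D - ∑ i ∈ D, (p j i + ε * q j i)
  cap : ∀ i, (H i).card ≤ b
  zero : ∀ i, (H i).card < b → ∀ j, q j i = 0
  near : ∀ i j k, k ∈ H i → q j i ≤ q k i + 1
  bd : ∀ i j, q j i ≤ B

/-- The potential at a machine. -/
def aucPot {M K : Type} [Fintype M] [Fintype K] (H : M → Finset K) (q : K → M → ℕ) (i : M) : ℕ :=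
  ∑ k ∈ H i, (1 + q k i) + ∑ k, q k i

lemma aucPot_lt {M K : Type} [Fintype M] [Fintype K] (H H' : M → Finset K) (q q' : K → M → ℕ)
    (i : M) (h : ∀ i', i' ≠ i → aucPot H' q' i' = aucPot H q i')
    (hi : aucPot H q i < aucPot H' q' i) :
    ∑ i, aucPot H q i < ∑ i, aucPot H' q' i := by
  apply Finset.sum_lt_sum
  · intro i' _
    by_cases e : i' = i
    · subst e; exact hi.le
    · exact (h i' e).ge
  · exact ⟨i, mem_univ _, hi⟩

lemma aucPot_le {M K : Type} [Fintype M] [Fintype K] (H : M → Finset K) (q : K → M → ℕ) (B : ℕ)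
    (h : ∀ i j, q j i ≤ B) :
    ∑ i, aucPot H q i ≤ ∑ _i : M, (∑ _k : K, (1 + B) + ∑ _k : K, B) := by
  apply Finset.sum_le_sum
  intro i _
  unfold aucPot
  apply add_le_add
  · calc ∑ k ∈ H i, (1 + q k i) ≤ ∑ k, (1 + q k i) :=
          Finset.sum_le_sum_of_subset (subset_univ _)
      _ ≤ _ := Finset.sum_le_sum (fun k _ => by have := h i k; omega)
  · exact Finset.sum_le_sum (fun k _ => h i k)

/-- One step of the auction. -/
lemma auc_step {M K : Type} [Fintype M] [Fintype K] (g : K → Finset M → ℝ) (p : K → M → ℝ)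
    (hgM : ∀ j, MnatConcave (g j))
    (b : ℕ) (ε : ℝ) (hε : 0 < ε) (N : ℕ)
    (hN : ∀ j (D : Finset M) i, g j D - g j (D.erase i) - p j i ≤ ε * N)
    (H : M → Finset K) (q : K → M → ℕ) (hI : AucInv g p b ε (N + 1) H q) :
    (∀ j, ∀ T : Finset M, g j T - ∑ i ∈ T, (p j i + ε * q j i) ≤
      g j (univ.filter fun i => j ∈ H i) -
        ∑ i ∈ univ.filter (fun i => j ∈ H i), (p j i + ε * q j i)) ∨
    ∃ H' q', AucInv g p b ε (N + 1) H' q' ∧ ∑ i, aucPot H q i < ∑ i, aucPot H' q' i := by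
  by_contra hcon
  push Not at hcon
  obtain ⟨⟨j, T, hT⟩, hno⟩ := hcon
  obtain ⟨D, hD, hmax⟩ := hI.dem j
  have hne : ∃ i ∈ D, j ∉ H i := by
    by_contra hc
    push Not at hc
    have : (univ.filter fun i => j ∈ H i) = D := by
      ext i
      simp only [mem_filter, mem_univ, true_and]
      exact ⟨hD i, hc i⟩
    rw [this] at hT
    exact absurd (hmax T) (not_le.mpr hT)
  obtain ⟨i, hiD, hij⟩ := hne
  by_cases hfull : (H i).card < b
  · -- take a free slot
    have hz := hI.zero i hfull
    refine absurd ?_ (not_lt.mpr (hno (Function.update H i (insert j (H i))) q ?_))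
    · apply aucPot_lt _ _ _ _ i
      · intro i' hi'
        simp [aucPot, Function.update_of_ne hi']
      · simp only [aucPot, Function.update_self]
        rw [Finset.sum_insert hij]
        omega
    · refine ⟨?_, ?_, ?_, ?_, hI.bd⟩
      · intro j'
        by_cases e : j' = j
        · subst e
          refine ⟨D, ?_, hmax⟩
          intro i' hi'
          by_cases e' : i' = i
          · subst e'; exact hiD
          · rw [Function.update_of_ne e'] at hi'
            exact hD _ hi'
        · obtain ⟨D', hD', hmax'⟩ := hI.dem j'
          refine ⟨D', ?_, hmax'⟩
          intro i' hi'
          by_cases e' : i' = i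
          · subst e'
            rw [Function.update_self, mem_insert] at hi'
            exact hD' _ (hi'.resolve_left e)
          · rw [Function.update_of_ne e'] at hi'
            exact hD' _ hi'
      · intro i'
        by_cases e' : i' = i
        · subst e'
          rw [Function.update_self, card_insert_of_notMem hij]
          omega
        · rw [Function.update_of_ne e']; exact hI.cap i'
      · intro i'
        by_cases e' : i' = i
        · subst e'
          intro _; exact hz
        · rw [Function.update_of_ne e']; exact hI.zero i'
      · intro i' j' k hk
        by_cases e' : i' = i
        · subst e'
          rw [hz j']; omega
        · rw [Function.update_of_ne e'] at hk
          exact hI.near i' j' k hk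
  · have hfull' : (H i).card = b := le_antisymm (hI.cap i) (not_lt.mp hfull)
    by_cases hlow : ∃ k ∈ H i, q k i < q j i
    · -- kick out a lower holder
      obtain ⟨k, hk, hkq⟩ := hlow
      have hjk : j ≠ k := fun e => hij (e ▸ hk)
      have hij' : j ∉ (H i).erase k := fun h => hij (mem_of_mem_erase h)
      refine absurd ?_ (not_lt.mpr (hno (Function.update H i (insert j ((H i).erase k))) q ?_))
      · apply aucPot_lt _ _ _ _ i
        · intro i' hi'
          simp [aucPot, Function.update_of_ne hi']
        · simp only [aucPot, Function.update_self]
          rw [Finset.sum_insert hij', ← Finset.add_sum_erase _ _ hk]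
          omega
      · refine ⟨?_, ?_, ?_, ?_, hI.bd⟩
        · intro j'
          by_cases e : j' = j
          · subst e
            refine ⟨D, ?_, hmax⟩
            intro i' hi'
            by_cases e' : i' = i
            · subst e'; exact hiD
            · rw [Function.update_of_ne e'] at hi'
              exact hD _ hi'
          · obtain ⟨D', hD', hmax'⟩ := hI.dem j'
            refine ⟨D', ?_, hmax'⟩
            intro i' hi'
            by_cases e' : i' = i
            · subst e'
              rw [Function.update_self, mem_insert] at hi'
              exact hD' _ (mem_of_mem_erase (hi'.resolve_left e))
            · rw [Function.update_of_ne e'] at hi'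
              exact hD' _ hi'
        · intro i'
          by_cases e' : i' = i
          · subst e'
            rw [Function.update_self, card_insert_of_notMem hij', card_erase_add_one hk]
            omega
          · rw [Function.update_of_ne e']; exact hI.cap i'
        · intro i'
          by_cases e' : i' = i
          · subst e'
            rw [Function.update_self, card_insert_of_notMem hij', card_erase_add_one hk]
            intro h; omega
          · rw [Function.update_of_ne e']; exact hI.zero i'
        · intro i' j' k' hk'
          by_cases e' : i' = i
          · subst e'
            rw [Function.update_self, mem_insert] at hk'
            rcases hk' with rfl | hk'
            · have := hI.near i' j' k hk
              omega
            · exact hI.near i' j' k' (mem_of_mem_erase hk')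
          · rw [Function.update_of_ne e'] at hk'
            exact hI.near i' j' k' hk'
    · -- raise the price
      push Not at hlow
      set q' : K → M → ℕ := fun j' i' => if j' = j ∧ i' = i then q j i + 1 else q j' i' with hq'
      have q1 : q' j i = q j i + 1 := by simp [hq']
      have q2 : ∀ j' i', i' ≠ i → q' j' i' = q j' i' := fun j' i' h => by simp [hq', h]
      have q3 : ∀ j' i', j' ≠ j → q' j' i' = q j' i' := fun j' i' h => by simp [hq', h]
      have q4 : ∀ j' i', q j' i' ≤ q' j' i' := by
        intro j' i'
        by_cases h : j' = j
        · by_cases h' : i' = i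
          · subst h h'; omega
          · exact (q2 j' i' h').ge
        · exact (q3 j' i' h).ge
      have hHq : ∀ i' k, k ∈ H i' → q' k i' = q k i' := by
        intro i' k hk
        by_cases h : k = j
        · subst h
          apply q2
          rintro rfl
          exact hij hk
        · exact q3 k i' h
      refine absurd ?_ (not_lt.mpr (hno H q' ?_))
      · apply aucPot_lt _ _ _ _ i
        · intro i' hi'
          simp [aucPot, q2 _ _ hi']
        · unfold aucPot
          rw [Finset.sum_congr rfl (fun k hk => by rw [hHq i k hk] :
            ∀ k ∈ H i, (1 + q' k i) = 1 + q k i)]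
          apply Nat.add_lt_add_left
          apply Finset.sum_lt_sum (fun k _ => q4 k i)
          exact ⟨j, mem_univ _, by omega⟩
      · refine ⟨?_, hI.cap, ?_, ?_, ?_⟩
        · intro j'
          by_cases e : j' = j
          · subst e
            obtain ⟨D'', hd1, hd2⟩ := hgM j' (fun i => p j' i + ε * q j' i)
              (fun i => p j' i + ε * q' j' i) (by
                intro i'
                have : (q j' i' : ℝ) ≤ q' j' i' := by exact_mod_cast q4 j' i'
                have := mul_le_mul_of_nonneg_left this hε.le
                linarith) D hmax
            refine ⟨D'', ?_, hd1⟩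
            intro i' hi'
            apply hd2 i' (hD i' hi')
            rw [hHq i' j' hi']
          · obtain ⟨D', hD', hmax'⟩ := hI.dem j'
            refine ⟨D', hD', ?_⟩
            simpa only [q3 j' _ e] using hmax'
        · intro i' hi' j'
          have hne : i' ≠ i := by rintro rfl; exact hfull hi'
          rw [q2 _ _ hne]; exact hI.zero i' hi' j'
        · intro i' j' k hk
          rw [hHq i' k hk]
          by_cases h : j' = j
          · by_cases h' : i' = i
            · subst h h'
              have := hlow k hk
              omega
            · rw [q2 _ _ h']; exact hI.near i' j' k hk
          · rw [q3 _ _ h]; exact hI.near i' j' k hk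
        · intro i' j'
          by_cases h : j' = j
          · by_cases h' : i' = i
            · subst h h'
              rw [q1]
              have h1 := hmax (D.erase i')
              have h2 := hN j' D i'
              rw [← Finset.add_sum_erase _ _ hiD] at h1
              have h3 : ε * q j' i' ≤ ε * N := by linarith
              have h4 : (q j' i' : ℝ) ≤ N := le_of_mul_le_mul_left h3 hε
              have : q j' i' ≤ N := by exact_mod_cast h4
              omega
            · rw [q2 _ _ h']; exact hI.bd i' j'
          · rw [q3 _ _ h]; exact hI.bd i' j'

/-- The auction terminates. -/
lemma auc_term {M K : Type} [Fintype M] [Fintype K] (g : K → Finset M → ℝ) (p : K → M → ℝ)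
    (hgM : ∀ j, MnatConcave (g j))
    (b : ℕ) (ε : ℝ) (hε : 0 < ε) (N : ℕ)
    (hN : ∀ j (D : Finset M) i, g j D - g j (D.erase i) - p j i ≤ ε * N) :
    ∀ (n : ℕ) (H : M → Finset K) (q : K → M → ℕ), AucInv g p b ε (N + 1) H q →
      (∑ _i : M, (∑ _k : K, (1 + (N + 1)) + ∑ _k : K, (N + 1))) ≤ n + ∑ i, aucPot H q i →
    ∃ (H : M → Finset K) (q : K → M → ℕ), AucInv g p b ε (N + 1) H q ∧
     (∀ j, ∀ T : Finset M, g j T - ∑ i ∈ T, (p j i + ε * q j i) ≤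
      g j (univ.filter fun i => j ∈ H i) -
        ∑ i ∈ univ.filter (fun i => j ∈ H i), (p j i + ε * q j i)) := by
  intro n
  induction n with
  | zero =>
    intro H q hI hn
    rcases auc_step g p hgM b ε hε N hN H q hI with h | ⟨H', q', hI', hlt⟩
    · exact ⟨H, q, hI, h⟩
    · have := aucPot_le H' q' (N + 1) hI'.bd
      omega
  | succ n ih =>
    intro H q hI hn
    rcases auc_step g p hgM b ε hε N hN H q hI with h | ⟨H', q', hI', hlt⟩
    · exact ⟨H, q, hI, h⟩
    · exact ih H' q' hI' (by omega)

lemma auc_sum {M K : Type} [Fintype M] [Fintype K] (H : M → Finset K) (f : K → M → ℝ) :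
    ∑ j, ∑ i ∈ univ.filter (fun i => j ∈ H i), f j i = ∑ i, ∑ j ∈ H i, f j i := by
  simp_rw [Finset.sum_filter]
  rw [Finset.sum_comm]
  apply Finset.sum_congr rfl
  intro i _
  rw [← Finset.sum_filter]
  simp

/-- Approximate rounding. -/
lemma auc_approx {M K : Type} [Fintype M] [Fintype K] (g : K → Finset M → ℝ) (p : K → M → ℝ)
    (hgM : ∀ j, MnatConcave (g j))
    (b : ℕ) (hb : 0 < b) (V : K → ℝ) (hV : ∀ j T, g j T - ∑ i ∈ T, p j i ≤ V j)
    (y : K → Finset M → ℝ) (hy0 : ∀ j T, 0 ≤ y j T) (hy1 : ∀ j, ∑ T, y j T = 1)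
    (hyV : ∀ j T, y j T ≠ 0 → g j T - ∑ i ∈ T, p j i = V j)
    (hload : ∀ i, ∑ j, ∑ T ∈ univ.filter (fun T : Finset M => i ∈ T), y j T ≤ b)
    (ε : ℝ) (hε : 0 < ε) :
    ∃ H : M → Finset K, (∀ i, (H i).card ≤ b) ∧
      ∀ j, V j - (g j (univ.filter fun i => j ∈ H i) - ∑ i ∈ univ.filter (fun i => j ∈ H i), p j i)
        ≤ ε * (b * Fintype.card M) := by
  obtain ⟨W, hW⟩ := Finite.exists_le (fun t : K × Finset M × M =>
    g t.1 t.2.1 - g t.1 (t.2.1.erase t.2.2) - p t.1 t.2.2)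
  obtain ⟨N, hN⟩ := exists_nat_ge (W / ε)
  have hN' : ∀ j (D : Finset M) i, g j D - g j (D.erase i) - p j i ≤ ε * N := by
    intro j D i
    have h1 := hW (j, D, i)
    rw [div_le_iff₀ hε] at hN
    simp only at h1
    linarith
  have h0 : AucInv g p b ε (N + 1) (fun _ => (∅ : Finset K)) (fun _ _ => 0) := by
    refine ⟨?_, by simp, by simp, by simp, by simp⟩
    intro j
    obtain ⟨D, _, hD⟩ := Finset.exists_max_image (univ : Finset (Finset M))
      (fun T => g j T - ∑ i ∈ T, (p j i + ε * ((0 : ℕ) : ℝ))) ⟨∅, mem_univ _⟩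
    exact ⟨D, by simp, fun T => hD T (mem_univ _)⟩
  obtain ⟨H, q, hI, hfin⟩ := auc_term g p hgM b ε hε N hN' _ _ _ h0 (Nat.le_add_right _ _)
  refine ⟨H, hI.cap, ?_⟩
  -- fractional usage
  set z : K → M → ℝ := fun j i => ∑ T ∈ univ.filter (fun T : Finset M => i ∈ T), y j T with hz
  have hz0 : ∀ j i, 0 ≤ z j i := fun j i => Finset.sum_nonneg (fun T _ => hy0 j T)
  set U : K → ℝ := fun j => g j (univ.filter fun i => j ∈ H i) -
    ∑ i ∈ univ.filter (fun i => j ∈ H i), p j i with hU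
  have key : ∀ j, V j - U j ≤ ε * ∑ i, (q j i : ℝ) * z j i -
      ε * ∑ i ∈ univ.filter (fun i => j ∈ H i), (q j i : ℝ) := by
    intro j
    have h1 : ∀ T, y j T * (V j - ε * ∑ i ∈ T, (q j i : ℝ)) ≤
        y j T * (U j - ε * ∑ i ∈ univ.filter (fun i => j ∈ H i), (q j i : ℝ)) := by
      intro T
      by_cases h : y j T = 0
      · simp [h]
      · apply mul_le_mul_of_nonneg_left _ (hy0 j T)
        have h2 := hfin j T
        rw [Finset.sum_add_distrib, Finset.sum_add_distrib, ← Finset.mul_sum,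
          ← Finset.mul_sum] at h2
        have h3 := hyV j T h
        simp only [hU]
        linarith
    have h2 := Finset.sum_le_sum (s := univ) (fun T _ => h1 T)
    rw [← Finset.sum_mul, hy1, one_mul] at h2
    simp_rw [mul_sub] at h2
    rw [Finset.sum_sub_distrib, ← Finset.sum_mul, hy1, one_mul] at h2
    have h3 : ∑ T, y j T * (ε * ∑ i ∈ T, (q j i : ℝ)) = ε * ∑ i, (q j i : ℝ) * z j i := by
      simp only [hz, Finset.mul_sum, Finset.sum_filter]
      rw [Finset.sum_comm]
      apply Finset.sum_congr rfl
      intro T _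
      rw [← Finset.sum_filter_add_sum_filter_not univ (fun i => i ∈ T)]
      rw [Finset.sum_congr rfl (g := fun _ => (0:ℝ)) (s₁ := univ.filter (fun i => ¬ i ∈ T))]
      · simp only [sum_const_zero, add_zero]
        have : univ.filter (fun i => i ∈ T) = T := by ext; simp
        rw [this]
        apply Finset.sum_congr rfl
        intro i hi
        simp only [hi, if_true]
        ring
      · intro i hi
        simp only [mem_filter, mem_univ, true_and] at hi
        simp [hi]
    linarith
  have hmach : ∀ i, ∑ j, (q j i : ℝ) * z j i ≤ ∑ j ∈ H i, (q j i : ℝ) + b := by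
    intro i
    have hA : 0 ≤ ∑ j ∈ H i, (q j i : ℝ) + b := by positivity
    have hb' : (0 : ℝ) < b := by exact_mod_cast hb
    have h1 : ∀ j, (q j i : ℝ) ≤ (∑ j ∈ H i, (q j i : ℝ) + b) / b := by
      intro j
      rcases lt_or_eq_of_le (hI.cap i) with h | h
      · rw [hI.zero i h j]
        simp only [Nat.cast_zero]
        positivity
      · rw [le_div_iff₀ hb']
        have : ∑ k ∈ H i, (q j i : ℝ) ≤ ∑ k ∈ H i, ((q k i : ℝ) + 1) :=
          Finset.sum_le_sum (fun k hk => by exact_mod_cast hI.near i j k hk)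
        rw [Finset.sum_add_distrib, Finset.sum_const, Finset.sum_const, h] at this
        simp only [nsmul_eq_mul, mul_one] at this
        linarith
    calc ∑ j, (q j i : ℝ) * z j i
        ≤ ∑ j, (∑ j ∈ H i, (q j i : ℝ) + b) / b * z j i :=
          Finset.sum_le_sum (fun j _ => mul_le_mul_of_nonneg_right (h1 j) (hz0 j i))
      _ = (∑ j ∈ H i, (q j i : ℝ) + b) / b * ∑ j, z j i := by rw [Finset.mul_sum]
      _ ≤ (∑ j ∈ H i, (q j i : ℝ) + b) / b * b :=
          mul_le_mul_of_nonneg_left (hload i) (div_nonneg hA hb'.le)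
      _ = _ := by field_simp
  have htot : ∑ j, (V j - U j) ≤ ε * (b * Fintype.card M) := by
    have h1 := Finset.sum_le_sum (s := univ) (fun j _ => key j)
    rw [Finset.sum_sub_distrib (s := univ) (f := fun j => ε * ∑ i, (q j i : ℝ) * z j i),
      ← Finset.mul_sum, ← Finset.mul_sum, auc_sum H (fun j i => (q j i : ℝ)),
      Finset.sum_comm (f := fun j i => (q j i : ℝ) * z j i)] at h1
    have h2 := Finset.sum_le_sum (s := univ) (fun i _ => hmach i)
    rw [Finset.sum_add_distrib, Finset.sum_const, card_univ, nsmul_eq_mul] at h2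
    have h3 := mul_le_mul_of_nonneg_left h2 hε.le
    nlinarith
  intro j
  refine le_trans ?_ htot
  exact Finset.single_le_sum (f := fun j => V j - U j)
    (fun j _ => sub_nonneg.mpr (hV j _)) (mem_univ j)

/-- Exact rounding. -/
lemma auc_round {M K : Type} [Fintype M] [Fintype K] (g : K → Finset M → ℝ) (p : K → M → ℝ)
    (hgM : ∀ j, MnatConcave (g j))
    (b : ℕ) (hb : 0 < b) (V : K → ℝ) (hV : ∀ j T, g j T - ∑ i ∈ T, p j i ≤ V j)
    (y : K → Finset M → ℝ) (hy0 : ∀ j T, 0 ≤ y j T) (hy1 : ∀ j, ∑ T, y j T = 1)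
    (hyV : ∀ j T, y j T ≠ 0 → g j T - ∑ i ∈ T, p j i = V j)
    (hload : ∀ i, ∑ j, ∑ T ∈ univ.filter (fun T : Finset M => i ∈ T), y j T ≤ b) :
    ∃ H : M → Finset K, (∀ i, (H i).card ≤ b) ∧
      ∀ j, g j (univ.filter fun i => j ∈ H i) - ∑ i ∈ univ.filter (fun i => j ∈ H i), p j i
        = V j := by
  -- the gap
  obtain ⟨W, hW⟩ := Finite.exists_le (fun t : K × Finset M =>
    (V t.1 - (g t.1 t.2 - ∑ i ∈ t.2, p t.1 i))⁻¹)
  have hX : (0 : ℝ) < max W 1 := lt_max_of_lt_right one_pos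
  set R : ℝ := b * Fintype.card M + 1 with hR
  have hRpos : 0 < R := by positivity
  obtain ⟨H, hH, hd⟩ := auc_approx g p hgM b hb V hV y hy0 hy1 hyV hload
    ((max W 1)⁻¹ / R) (by positivity)
  refine ⟨H, hH, fun j => ?_⟩
  by_contra hne
  have hpos := sub_pos.mpr (lt_of_le_of_ne (hV j _) hne)
  have h1 := (hW (j, univ.filter fun i => j ∈ H i)).trans (le_max_left W 1)
  have h2 := hd j
  simp only at h1
  have h3 := inv_anti₀ (inv_pos.mpr hpos) h1
  rw [inv_inv] at h3
  have h4 : (max W 1)⁻¹ / R * (b * Fintype.card M) < (max W 1)⁻¹ := by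
    rw [div_mul_eq_mul_div, div_lt_iff₀ hRpos]
    apply mul_lt_mul_of_pos_left _ (inv_pos.mpr hX)
    rw [hR]; linarith
  linarith

/-- Complementary slackness. -/
lemma gs_slack {M J : Type} [Fintype M] [Fintype J] (g : J → Finset M → ℝ)
    (hgpos : ∀ j (S : Finset M), S.Nonempty → 0 < g j S)
    (C : ℝ) (x : Finset M → J → ℝ) (s : M → ℝ) (lam : J → ℝ) (mu : M → ℝ)
    (hx : GSFeasible g C x s) (hd : GSDFeasible g C lam mu)
    (hobj : ∑ i : M, s i = GSDObj C lam mu) (j : J) (S : Finset M) (hS : x S j ≠ 0) :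
    S.Nonempty ∧ (2 * g j S - C⁻¹) * lam j = ∑ i ∈ S, mu i := by
  obtain ⟨hx0, hxe, hs0, hxj, hxi⟩ := hx
  obtain ⟨hl0, hm1, hdS⟩ := hd
  have hSne : S.Nonempty := by
    rw [Finset.nonempty_iff_ne_empty]
    rintro rfl
    exact hS (hxe j)
  refine ⟨hSne, ?_⟩
  set t : J → Finset M → ℝ := fun j S =>
    x S j / g j S * (∑ i ∈ S, mu i - (2 * g j S - C⁻¹) * lam j) with ht
  have ht0 : ∀ j S, 0 ≤ t j S := by
    intro j S
    rcases S.eq_empty_or_nonempty with rfl | h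
    · simp [ht, hxe]
    · exact mul_nonneg (div_nonneg (hx0 _ _) (hgpos j S h).le) (by linarith [hdS j S h])
  have hsplit : ∀ j S, t j S = x S j / g j S * ∑ i ∈ S, mu i -
      lam j * (if S.Nonempty then (2 - (C * g j S)⁻¹) * x S j else 0) := by
    intro j S
    rcases S.eq_empty_or_nonempty with rfl | h
    · simp [ht, hxe]
    · have := (hgpos j S h).ne'
      simp only [ht, h, if_true]
      rw [mul_inv]
      field_simp
  have hsum1 : ∑ j, ∑ S, x S j / g j S * ∑ i ∈ S, mu i =
      ∑ i, mu i * ∑ j, ∑ S ∈ univ.filter (fun S : Finset M => i ∈ S), x S j / g j S := by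
    simp only [Finset.mul_sum, Finset.sum_filter]
    rw [Finset.sum_comm (s := (univ : Finset M))]
    apply Finset.sum_congr rfl
    intro j _
    rw [Finset.sum_comm (s := (univ : Finset M))]
    apply Finset.sum_congr rfl
    intro S _
    simp only [mul_ite, mul_zero]
    rw [← Finset.sum_filter]
    have : univ.filter (fun i => i ∈ S) = S := by ext; simp
    rw [this]
    exact Finset.sum_congr rfl (fun i _ => mul_comm _ _)
  have htot : ∑ j, ∑ S, t j S ≤ 0 := by
    simp only [hsplit, Finset.sum_sub_distrib, ← Finset.mul_sum, ← Finset.sum_filter]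
    simp only [Finset.mul_sum] at hsum1 ⊢
    rw [hsum1]
    simp only [← Finset.mul_sum]
    have h1 : ∑ j, lam j ≤ ∑ j, lam j *
        ∑ S ∈ univ.filter (fun S : Finset M => S.Nonempty), (2 - (C * g j S)⁻¹) * x S j :=
      Finset.sum_le_sum (fun j _ => le_mul_of_one_le_right (hl0 j) (hxj j))
    have h2 : ∑ i, mu i * ∑ j, ∑ S ∈ univ.filter (fun S : Finset M => i ∈ S), x S j / g j S
        ≤ ∑ i, (C * mu i - s i) := by
      apply Finset.sum_le_sum
      intro i _
      have a1 := hxi i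
      have a2 := hm1 i
      have a3 := hs0 i
      have a4 : mu i * ∑ j, ∑ S ∈ univ.filter (fun S : Finset M => i ∈ S), x S j / g j S
        ≤ mu i * (C - s i) := mul_le_mul_of_nonneg_left (by linarith) (by linarith)
      nlinarith
    rw [Finset.sum_sub_distrib, ← Finset.mul_sum, hobj, GSDObj] at h2
    linarith
  have hle : t j S ≤ 0 := by
    refine le_trans ?_ htot
    refine le_trans (Finset.single_le_sum (f := fun S => t j S) (fun S _ => ht0 j S)
      (mem_univ S)) ?_
    exact Finset.single_le_sum (f := fun j => ∑ S, t j S)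
      (fun j _ => Finset.sum_nonneg (fun S _ => ht0 j S)) (mem_univ j)
  have heq : t j S = 0 := le_antisymm hle (ht0 j S)
  simp only [ht, mul_eq_zero, div_eq_zero_iff] at heq
  rcases heq with (h | h) | h
  · exact absurd h hS
  · exact absurd h (hgpos j S hSne).ne'
  · linarith

/-- Step 2 (Lemma 6, existential content): for M♮-concave speeds and optimal primal-dual
solutions of (GS)/(GS-D), there is an assignment of the jobs in `J_2` in which every job
`j ∈ J_2` gets a nonempty machine set of speed at least `1/(2C)` and every machine is
used by at most `20` of these jobs (hence the load is at most `40 C`). -/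
theorem step2_low_speed_assignment (M J : Type) [Fintype M] [Fintype J]
    (g : J → Finset M → ℝ)
    (hg0 : ∀ j, g j ∅ = 0)
    (hgpos : ∀ j (S : Finset M), S.Nonempty → 0 < g j S)
    (hgM : ∀ j, MnatConcave (g j))
    (C : ℝ) (hC : 0 < C)
    (x : Finset M → J → ℝ) (s : M → ℝ) (lam : J → ℝ) (mu : M → ℝ)
    (hx : GSFeasible g C x s) (hd : GSDFeasible g C lam mu)
    (hobj : ∑ i : M, s i = GSDObj C lam mu)
    (hlam : ∀ j : J, 0 < lam j) :
    ∃ S : J → Finset M,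
      (∀ j ∈ J2 g C x lam mu, (S j).Nonempty ∧ 1 / (2 * C) ≤ g j (S j)) ∧
      ∀ i : M, ((J2 g C x lam mu).filter (fun j => i ∈ S j)).card ≤ 20 := by
  have hsl := gs_slack g hgpos C x s lam mu hx hd hobj
  obtain ⟨hx0, hxe, hs0, hxj, hxi⟩ := hx
  obtain ⟨hl0, hm1, hdS⟩ := hd
  set A := J2 g C x lam mu with hA
  set F : J → Finset (Finset M) := fun j =>
    Finset.univ.filter (fun S : Finset M => ∑ i ∈ S, mu i / lam j ≤ 4 / C) with hF
  have hX : ∀ j ∈ A, 1 / 8 ≤ ∑ S ∈ F j, x S j := by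
    intro j hj
    rw [hA, J2, mem_filter] at hj
    exact hj.2
  set X : J → ℝ := fun j => ∑ S ∈ F j, x S j with hXd
  have hpsum : ∀ j (S : Finset M), ∑ i ∈ S, mu i / (2 * lam j) = (∑ i ∈ S, mu i) / (2 * lam j) :=
    fun j S => (Finset.sum_div _ _ _).symm
  -- the value of every set
  have hval : ∀ j (S : Finset M), x S j ≠ 0 →
      g j S - ∑ i ∈ S, mu i / (2 * lam j) = 1 / (2 * C) := by
    intro j S h
    have h1 := (hsl j S h).2
    have := hlam j
    rw [hpsum, ← h1]
    field_simp
    ring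
  have hle : ∀ j (S : Finset M), g j S - ∑ i ∈ S, mu i / (2 * lam j) ≤ 1 / (2 * C) := by
    intro j S
    rcases S.eq_empty_or_nonempty with rfl | h
    · simp only [hg0, sum_empty, sub_zero]; positivity
    · have h1 := hdS j S h
      have hl := hlam j
      rw [hpsum, sub_le_iff_le_add, ← sub_le_iff_le_add', le_div_iff₀ (by positivity)]
      have : (g j S - 1 / (2 * C)) * (2 * lam j) = (2 * g j S - C⁻¹) * lam j := by
        field_simp
      linarith
  -- contribution to machine usage
  have hxg : ∀ j, ∀ S ∈ F j, x S j ≤ 5 / (2 * C) * (x S j / g j S) := by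
    intro j S hS
    by_cases h : x S j = 0
    · simp [h]
    · have h1 := hval j S h
      have hne := (hsl j S h).1
      have hgp := hgpos j S hne
      simp only [hF, mem_filter, mem_univ, true_and] at hS
      have h2 : ∑ i ∈ S, mu i / (2 * lam j) = (∑ i ∈ S, mu i / lam j) / 2 := by
        rw [Finset.sum_div]
        exact Finset.sum_congr rfl (fun i _ => by rw [div_div, mul_comm])
      have h3 : g j S ≤ 5 / (2 * C) := by
        have e1 : 5 / (2 * C) = 1 / (2 * C) + (4 / C) / 2 := by field_simp; norm_num
        rw [e1]; linarith
      have h4 : 0 ≤ x S j / g j S := div_nonneg (hx0 _ _) hgp.le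
      calc x S j = g j S * (x S j / g j S) := by field_simp
        _ ≤ _ := mul_le_mul_of_nonneg_right h3 h4
  have hxg0 : ∀ j (S : Finset M), 0 ≤ x S j / g j S := by
    intro j S
    rcases S.eq_empty_or_nonempty with rfl | h
    · simp [hxe]
    · exact div_nonneg (hx0 _ _) (hgpos j S h).le
  obtain ⟨H, hHc, hHv⟩ := auc_round (K := {j // j ∈ A}) (fun j => g j.1)
    (fun j i => mu i / (2 * lam j.1)) (fun j => hgM j.1) 20 (by norm_num)
    (fun _ => 1 / (2 * C)) (fun j T => hle j.1 T)
    (fun j S => if S ∈ F j.1 then x S j.1 / X j.1 else 0)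
    (by
      intro j T
      have := hX j.1 j.2
      split_ifs
      · exact div_nonneg (hx0 _ _) (by simp only [hXd]; linarith)
      · exact le_rfl)
    (by
      intro j
      have := hX j.1 j.2
      rw [← Finset.sum_filter, ← Finset.sum_div]
      have e : univ.filter (fun S => S ∈ F j.1) = F j.1 := by ext; simp
      rw [e]
      exact div_self (by linarith))
    (by
      intro j T h
      apply hval
      intro h0
      simp [h0] at h)
    (by
      intro i
      have h1 : ∀ j : {j // j ∈ A}, ∑ T ∈ univ.filter (fun T : Finset M => i ∈ T),
          (if T ∈ F j.1 then x T j.1 / X j.1 else 0) ≤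
          20 / C * ∑ T ∈ univ.filter (fun T : Finset M => i ∈ T), x T j.1 / g j.1 T := by
        intro j
        rw [Finset.mul_sum]
        apply Finset.sum_le_sum
        intro T _
        have h0 := hxg0 j.1 T
        split_ifs with hT
        · have hXj : 1 / 8 ≤ X j.1 := hX j.1 j.2
          have h2 := hxg j.1 T hT
          rw [div_le_iff₀ (by linarith)]
          have h3 : 0 ≤ 20 / C * (x T j.1 / g j.1 T) := by positivity
          have h4 := mul_le_mul_of_nonneg_left hXj h3
          refine le_trans h2 (le_trans (le_of_eq ?_) h4)
          field_simp
          ring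
        · positivity
      refine le_trans (Finset.sum_le_sum (fun j _ => h1 j)) ?_
      rw [← Finset.mul_sum]
      have h5 : ∑ j : {j // j ∈ A}, ∑ T ∈ univ.filter (fun T : Finset M => i ∈ T),
          x T j.1 / g j.1 T ≤ C := by
        rw [Finset.sum_coe_sort A (fun j => ∑ T ∈ univ.filter (fun T : Finset M => i ∈ T),
          x T j / g j T)]
        refine le_trans (Finset.sum_le_sum_of_subset_of_nonneg (subset_univ A)
          (fun j _ _ => Finset.sum_nonneg (fun T _ => hxg0 j T))) ?_
        linarith [hxi i, hs0 i]
      have h6 := mul_le_mul_of_nonneg_left h5 (show 0 ≤ 20 / C by positivity)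
      refine le_trans h6 (le_of_eq ?_)
      push_cast
      field_simp)
  refine ⟨fun j => if h : j ∈ A then univ.filter (fun i => (⟨j, h⟩ : {j // j ∈ A}) ∈ H i) else ∅,
    ?_, ?_⟩
  · intro j hj
    beta_reduce
    rw [dif_pos hj]
    have h1 : g j (univ.filter (fun i => (⟨j, hj⟩ : {j // j ∈ A}) ∈ H i)) -
        ∑ i ∈ univ.filter (fun i => (⟨j, hj⟩ : {j // j ∈ A}) ∈ H i), mu i / (2 * lam j)
        = 1 / (2 * C) := by
      convert hHv ⟨j, hj⟩
    have hl := hlam j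
    have h2 : (0 : ℝ) < 1 / (2 * C) := by positivity
    constructor
    · rw [Finset.nonempty_iff_ne_empty]
      intro h0
      rw [h0] at h1
      simp only [hg0, sum_empty, sub_zero] at h1
      linarith
    · have : 0 ≤ ∑ i ∈ univ.filter (fun i => (⟨j, hj⟩ : {j // j ∈ A}) ∈ H i),
          mu i / (2 * lam j) :=
        Finset.sum_nonneg (fun i _ => div_nonneg (by linarith [hm1 i]) (by positivity))
      linarith
  · intro i
    refine le_trans ?_ (hHc i)
    rw [← Finset.card_map (Function.Embedding.subtype _)]
    apply Finset.card_le_card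
    intro j hj
    simp only [mem_filter] at hj
    obtain ⟨hj, hj2⟩ := hj
    simp only [hj, dif_pos, mem_filter, mem_univ, true_and] at hj2
    simp only [Finset.mem_map]
    exact ⟨⟨j, hj⟩, hj2, rfl⟩
end

section
/- Let every processing speed function g_j be M♮-concave, let (x, s) and (λ, μ) be optimal solutions to (GS) and (GS-D) for target C > 0 (feasible solutions with coinciding objective values, and λ_j > 0 for all j), and let J_3 := J ∖ (J_1 ∪ J_2). Then there exists a family (S_j)_{j∈J_3} of nonempty subsets of M such that g_j(S_j) ≥ 69/(320C) for every j ∈ J_3 and every machine i ∈ M belongs to at most 26 of the sets S_j; in particular, the assignment (S_j)_{j∈J_3} of the jobs in J_3 has maximum machine load at most 121C. (Existential content of Lemma 7 / Step 3.) -/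
open Finset
open scoped Classical

theorem aux_transversal {L E : Type} [Fintype L] [Fintype E] [DecidableEq E] (f : L → Finset E → ℕ) (m : L → ℕ)
    (hmono : ∀ l X Y, X ⊆ Y → f l X ≤ f l Y)
    (hsub : ∀ l X Y, f l (X ∪ Y) + f l (X ∩ Y) ≤ f l X + f l Y)
    (hle : ∀ l X, f l X ≤ m l)
    (hcond : ∀ I : Finset E, ∑ l, m l ≤ ∑ l, f l I + (univ \ I).card) :
    ∃ F : L → Finset E, (∀ l, m l ≤ f l (F l)) ∧ ∀ e l l', e ∈ F l → e ∈ F l' → l = l' := by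
  let P : (L → Finset E) → Prop := fun F =>
    ∀ I : Finset E, ∑ l, m l ≤ ∑ l, f l (F l ∩ I) + (univ \ I).card
  have hP0 : P (fun _ => univ) := by
    intro I
    simpa using hcond I
  obtain ⟨F, hF, hmin⟩ := (Set.toFinite {F | P F}).exists_minimal ⟨_, hP0⟩
  refine ⟨F, ?_, ?_⟩
  · have h := hF univ
    simp only [inter_univ, sdiff_self] at h
    replace h : ∑ l, m l ≤ ∑ l, f l (F l) := by simpa using h
    have h2 : ∑ l, f l (F l) ≤ ∑ l, m l := sum_le_sum fun l _ => hle l _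
    have h3 := (sum_eq_sum_iff_of_le (fun l _ => hle l (F l))).1 (le_antisymm h2 h)
    intro l
    exact (h3 l (mem_univ l)).ge
  · intro e j k hej hek
    by_contra hjk
    have key : ∀ j, e ∈ F j → ∃ I : Finset E, e ∈ I ∧
        ∑ l, f l (Function.update F j ((F j).erase e) l ∩ I) + (univ \ I).card + 1 ≤ ∑ l, m l := by
      intro j hej
      have hn : ¬ P (Function.update F j ((F j).erase e)) := by
        intro hp
        have hle' : Function.update F j ((F j).erase e) ≤ F := by
          intro l
          by_cases h : l = j
          · subst h; simp [erase_subset]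
          · simp [h]
        have := hmin hp hle' j
        simp only [Function.update_self] at this
        exact absurd (this hej) (by simp)
      simp only [P, not_forall, not_le] at hn
      obtain ⟨I, hI⟩ := hn
      refine ⟨I, ?_, by omega⟩
      by_contra heI
      have h1 := hF I
      have h2 : ∑ l, f l (Function.update F j ((F j).erase e) l ∩ I) = ∑ l, f l (F l ∩ I) := by
        refine sum_congr rfl fun l _ => ?_
        by_cases h : l = j
        · subst h
          simp only [Function.update_self]
          congr 1
          ext a
          simp only [mem_inter, mem_erase]
          constructor
          · rintro ⟨⟨_, h⟩, h'⟩; exact ⟨h, h'⟩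
          · rintro ⟨h, h'⟩; exact ⟨⟨fun h => heI (h ▸ h'), h⟩, h'⟩
        · simp [h]
      omega
    obtain ⟨I, heI, hI⟩ := key j hej
    obtain ⟨I', heI', hI'⟩ := key k hek
    have hU := hF (I ∪ I')
    have hN := hF ((I ∩ I').erase e)
    have hs : ∑ l, f l (F l ∩ (I ∪ I')) + ∑ l, f l (F l ∩ ((I ∩ I').erase e)) ≤
        ∑ l, f l (Function.update F j ((F j).erase e) l ∩ I) +
        ∑ l, f l (Function.update F k ((F k).erase e) l ∩ I') := by
      rw [← sum_add_distrib, ← sum_add_distrib]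
      refine sum_le_sum fun l _ => ?_
      refine le_trans (add_le_add (hmono l _ _ ?_) (hmono l _ _ ?_)) (hsub l _ _)
      · intro a ha
        by_cases h1 : l = j
        · have h2 : l ≠ k := fun h => hjk (h1 ▸ h)
          subst h1
          by_cases hae : a = e
          · subst hae; simp_all
          · simp_all
        · by_cases h2 : l = k
          · subst h2
            by_cases hae : a = e
            · subst hae; simp_all
            · simp_all
          · simp_all
      · intro a ha
        by_cases h1 : l = j
        · have h2 : l ≠ k := fun h => hjk (h1 ▸ h)
          subst h1
          simp_all
        · by_cases h2 : l = k
          · subst h2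
            simp_all
          · simp_all
    have hc : (univ \ (I ∪ I')).card + (univ \ ((I ∩ I').erase e)).card ≤
        (univ \ I).card + (univ \ I').card + 1 := by
      have h1 : (univ \ ((I ∩ I').erase e)) ⊆ insert e ((univ \ I) ∪ (univ \ I')) := by
        intro a ha
        simp only [mem_sdiff, mem_univ, true_and, mem_erase, mem_inter, mem_insert, mem_union] at ha ⊢
        tauto
      have h2 := card_le_card h1
      have h3 := card_insert_le e ((univ \ I) ∪ (univ \ I'))
      have h4 : univ \ (I ∪ I') = (univ \ I) ∩ (univ \ I') := by
        ext a; simp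
      have h5 := card_union_add_card_inter (univ \ I) (univ \ I')
      rw [h4]
      omega
    omega

/-- argmin-version of gross substitutes for a family of sets -/
def GSfam {M : Type} (D : Finset M → Prop) : Prop :=
  ∀ q' q'' : M → ℝ, (∀ i, q' i ≤ q'' i) → ∀ S', D S' →
    (∀ T, D T → ∑ i ∈ S', q' i ≤ ∑ i ∈ T, q' i) →
    ∃ S'', D S'' ∧ (∀ T, D T → ∑ i ∈ S'', q'' i ≤ ∑ i ∈ T, q'' i) ∧
      ∀ i ∈ S', q' i = q'' i → i ∈ S''

theorem aux_gsfam {M : Type} [Fintype M] (g : Finset M → ℝ) (hg : MnatConcave g) (p : M → ℝ)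
    (V : ℝ) (hV : ∀ T, g T - ∑ i ∈ T, p i ≤ V) :
    GSfam (fun S => g S - ∑ i ∈ S, p i = V) := by
  intro q' q'' hq S' hS' hmin
  have hgap : ∃ γ : ℝ, 0 < γ ∧ ∀ T, g T - ∑ i ∈ T, p i ≠ V → g T - ∑ i ∈ T, p i ≤ V - γ := by
    let A := (univ : Finset (Finset M)).filter (fun T => g T - ∑ i ∈ T, p i ≠ V)
    by_cases hA : A.Nonempty
    · obtain ⟨T0, hT0, hmax⟩ := A.exists_max_image (fun T => g T - ∑ i ∈ T, p i) hA
      refine ⟨V - (g T0 - ∑ i ∈ T0, p i), ?_, ?_⟩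
      · have := (mem_filter.1 hT0).2
        exact sub_pos.2 (lt_of_le_of_ne (hV T0) this)
      · intro T hT
        have := hmax T (mem_filter.2 ⟨mem_univ _, hT⟩)
        linarith
    · refine ⟨1, one_pos, fun T hT => ?_⟩
      exact absurd ⟨T, mem_filter.2 ⟨mem_univ _, hT⟩⟩ hA
  obtain ⟨γ, hγ, hgap⟩ := hgap
  have hB : ∀ q : M → ℝ, ∀ T : Finset M, |∑ i ∈ T, q i| ≤ ∑ i, |q i| := fun q T =>
    (abs_sum_le_sum_abs _ _).trans
      (sum_le_sum_of_subset_of_nonneg (subset_univ _) (fun _ _ _ => abs_nonneg _))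
  set B := ∑ i, |q' i| + ∑ i, |q'' i| + 1 with hBdef
  have hB1 : ∀ T : Finset M, |∑ i ∈ T, q' i| ≤ B := fun T => by
    have := hB q' T
    have h2 : 0 ≤ ∑ i, |q'' i| := sum_nonneg fun _ _ => abs_nonneg _
    linarith
  have hB2 : ∀ T : Finset M, |∑ i ∈ T, q'' i| ≤ B := fun T => by
    have := hB q'' T
    have h2 : 0 ≤ ∑ i, |q' i| := sum_nonneg fun _ _ => abs_nonneg _
    linarith
  have hBpos : 0 < B := by
    have h2 : 0 ≤ ∑ i, |q'' i| := sum_nonneg fun _ _ => abs_nonneg _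
    have h3 : 0 ≤ ∑ i, |q' i| := sum_nonneg fun _ _ => abs_nonneg _
    linarith
  set ε := γ / (4 * B) with hε
  have hεpos : 0 < ε := by positivity
  have hεB : ε * B = γ / 4 := by rw [hε]; field_simp
  have hsum : ∀ (q : M → ℝ) (T : Finset M), ∑ i ∈ T, (p i + ε * q i) =
      ∑ i ∈ T, p i + ε * ∑ i ∈ T, q i := fun q T => by
    rw [sum_add_distrib, mul_sum]
  have hb : ∀ a : ℝ, |a| ≤ B → -(γ/4) ≤ ε * a ∧ ε * a ≤ γ/4 := fun a ha => by
    have := abs_le.1 ha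
    constructor <;> nlinarith
  obtain ⟨S'', h1, h2⟩ := hg (fun i => p i + ε * q' i) (fun i => p i + ε * q'' i)
    (fun i => by have := hq i; nlinarith [mul_le_mul_of_nonneg_left this hεpos.le]) S' (by
      intro T
      rw [hsum, hsum]
      by_cases hT : g T - ∑ i ∈ T, p i = V
      · have := mul_le_mul_of_nonneg_left (hmin T hT) hεpos.le
        linarith
      · have := hgap T hT
        have h3 := hb _ (hB1 T)
        have h4 := hb _ (hB1 S')
        linarith)
  have hS'' : g S'' - ∑ i ∈ S'', p i = V := by
    by_contra hne
    have := hgap S'' hne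
    have h5 := h1 S'
    rw [hsum, hsum] at h5
    have h3 := hb _ (hB2 S'')
    have h4 := hb _ (hB2 S')
    linarith
  refine ⟨S'', hS'', ?_, ?_⟩
  · intro T hT
    have h5 := h1 T
    rw [hsum, hsum] at h5
    have : ε * ∑ i ∈ S'', q'' i ≤ ε * ∑ i ∈ T, q'' i := by linarith
    exact le_of_mul_le_mul_left this hεpos
  · intro i hi he
    exact h2 i hi (by simp [he])

/-- subsets of demanded sets -/
theorem aux_sub_demand {M : Type} [Fintype M] (g : Finset M → ℝ) (hg : MnatConcave g)
    (hg0 : g ∅ = 0) (p : M → ℝ)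
    (S : Finset M) (hS : ∀ T, g T - ∑ i ∈ T, p i ≤ g S - ∑ i ∈ S, p i) (T : Finset M)
    (hT : T ⊆ S) : ∑ i ∈ T, p i ≤ g T := by
  set V := g S - ∑ i ∈ S, p i with hVdef
  have hV0 : 0 ≤ V := by have := hS ∅; simpa [hg0] using this
  obtain ⟨S'', h1, h2⟩ := hg p (fun i => if i ∈ T then p i else p i + (V + 1))
    (fun i => by split_ifs <;> linarith) S hS
  have hTS : T ⊆ S'' := fun i hi => h2 i (hT hi) (by simp [hi])
  have h0 := h1 ∅
  simp only [hg0, sum_empty, sub_zero] at h0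
  have hsum : ∑ i ∈ S'', (if i ∈ T then p i else p i + (V + 1)) =
      ∑ i ∈ S'', p i + (V + 1) * (S'' \ T).card := by
    rw [← sum_sdiff hTS, ← sum_sdiff (f := p) hTS]
    rw [sum_congr rfl (g := fun i => p i + (V+1)) (fun i hi => by
      simp [(mem_sdiff.1 hi).2])]
    rw [sum_congr (s₁ := T) rfl (g := fun i => p i) (fun i hi => by simp [hi])]
    rw [sum_add_distrib, sum_const, nsmul_eq_mul]
    ring
  have hcard : (S'' \ T).card = 0 := by
    by_contra hne
    have h3 : (1 : ℝ) ≤ (S'' \ T).card := by exact_mod_cast Nat.one_le_iff_ne_zero.2 hne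
    rw [hsum] at h0
    have := hS S''
    nlinarith
  have heq : S'' = T := by
    apply Subset.antisymm _ hTS
    rwa [card_eq_zero, sdiff_eq_empty_iff_subset] at hcard
  rw [hsum, hcard, heq] at h0
  simp at h0
  linarith

noncomputable def rk {M : Type} [Fintype M] (D : Finset M → Prop) (X : Finset M) : ℕ :=
  (univ.filter D).sup (fun S => (S ∩ X).card)

theorem rk_ge {M : Type} [Fintype M] {D : Finset M → Prop} (X : Finset M) {S : Finset M}
    (hS : D S) : (S ∩ X).card ≤ rk D X :=
  le_sup (f := fun S : Finset M => (S ∩ X).card) (mem_filter.2 ⟨mem_univ S, hS⟩)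

theorem rk_attain {M : Type} [Fintype M] {D : Finset M → Prop} (hne : ∃ S, D S) (X : Finset M) :
    ∃ S, D S ∧ (S ∩ X).card = rk D X := by
  obtain ⟨S0, hS0⟩ := hne
  obtain ⟨S, hS, h⟩ := exists_mem_eq_sup (univ.filter D) ⟨S0, by simp [hS0]⟩
    (fun S => (S ∩ X).card)
  exact ⟨S, (mem_filter.1 hS).2, h.symm⟩

theorem rk_mono {M : Type} [Fintype M] (D : Finset M → Prop) {X Y : Finset M} (h : X ⊆ Y) :
    rk D X ≤ rk D Y :=
  sup_mono_fun fun _ _ => card_le_card (inter_subset_inter_left h)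

theorem rk_insert_le {M : Type} [Fintype M] (D : Finset M → Prop) (X : Finset M) (i : M) :
    rk D (insert i X) ≤ rk D X + 1 := by
  refine Finset.sup_le fun S hS => ?_
  have h1 := rk_ge X (mem_filter.1 hS).2
  have h2 : S ∩ insert i X ⊆ insert i (S ∩ X) := by
    intro a; simp only [mem_inter, mem_insert]; tauto
  have h3 := (card_le_card h2).trans (card_insert_le _ _)
  omega

theorem rk_local {M : Type} [Fintype M] {D : Finset M → Prop} (hD : GSfam D) (hne : ∃ S, D S)
    (A : Finset M) (i k : M) (hi : i ∉ A) (hk : k ∉ A) (hik : i ≠ k)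
    (h1 : rk D (insert i A) = rk D A) (h2 : rk D (insert k A) = rk D A) :
    rk D (insert i (insert k A)) = rk D A := by
  by_contra hcon
  have hge : rk D A ≤ rk D (insert i (insert k A)) := rk_mono D (by intro a; simp; tauto)
  obtain ⟨S, hS, hScard⟩ := rk_attain hne (insert i (insert k A))
  have hci : ∀ (S : Finset M) (i : M) (A : Finset M), i ∉ A →
      (S ∩ insert i A).card = (if i ∈ S then 1 else 0) + (S ∩ A).card := by
    intro S i A hi
    split_ifs with h
    · rw [inter_insert_of_mem h, card_insert_of_notMem (by simp [hi])]; omega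
    · rw [inter_insert_of_notMem h]; omega
  have e1 := fun S => hci S i A hi
  have e2 := fun S => hci S k A hk
  have e3 := fun S => hci S i (insert k A) (by simp [hi, hik])
  have b0 := fun S (h : D S) => rk_ge A h
  have b1 := fun S (h : D S) => rk_ge (insert i A) h
  have b2 := fun S (h : D S) => rk_ge (insert k A) h
  have hup := rk_insert_le D (insert k A) i
  let q' : M → ℝ := fun a => if a ∈ A then -2 else if a = i ∨ a = k then -1 else 0
  let q'' : M → ℝ := fun a => if a ∈ A then -2 else if a = k then -1 else 0
  have hq : ∀ a, q' a ≤ q'' a := by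
    intro a
    simp only [q', q'']
    split_ifs <;> simp_all
  have s1 : ∀ S : Finset M, ∑ a ∈ S, q' a = -(2 * ((S ∩ A).card : ℝ) + (if i ∈ S then 1 else 0)
      + (if k ∈ S then 1 else 0)) := by
    intro S
    have : ∀ a, q' a = (if a ∈ A then (-2:ℝ) else 0) + (if a = i then -1 else 0)
        + (if a = k then -1 else 0) := by
      intro a
      simp only [q']
      by_cases ha : a ∈ A
      · have : a ≠ i := fun h => hi (h ▸ ha)
        have : a ≠ k := fun h => hk (h ▸ ha)
        simp_all
      · by_cases hai : a = i
        · have : a ≠ k := fun h => hik (hai ▸ h)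
          simp_all
        · simp_all
    simp only [this, sum_add_distrib, sum_ite_eq', sum_ite_mem, sum_const,
      nsmul_eq_mul]
    split_ifs <;> ring
  have s2 : ∀ S : Finset M, ∑ a ∈ S, q'' a = -(2 * ((S ∩ A).card : ℝ)
      + (if k ∈ S then 1 else 0)) := by
    intro S
    have : ∀ a, q'' a = (if a ∈ A then (-2:ℝ) else 0)
        + (if a = k then -1 else 0) := by
      intro a
      simp only [q'']
      by_cases ha : a ∈ A
      · have : a ≠ k := fun h => hk (h ▸ ha)
        simp_all
      · simp_all
    simp only [this, sum_add_distrib, sum_ite_eq', sum_ite_mem, sum_const,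
      nsmul_eq_mul]
    split_ifs <;> ring
  have hSi : i ∈ S ∧ k ∈ S ∧ (S ∩ A).card + 1 = rk D A := by
    have x0 := b0 S hS
    have x1 := b1 S hS
    have x2 := b2 S hS
    have y1 := e1 S
    have y2 := e2 S
    have y3 := e3 S
    by_cases c1 : i ∈ S <;> by_cases c2 : k ∈ S <;> simp only [c1, c2, if_true, if_false] at y1 y2 y3 ⊢ <;> (try simp) <;> omega
  obtain ⟨hiS, hkS, hSA⟩ := hSi
  obtain ⟨S'', hS'', hm, hin⟩ := hD q' q'' hq S hS (by
    intro T hT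
    rw [s1, s1]
    have x0 := b0 T hT
    have x1 := b1 T hT
    have x2 := b2 T hT
    have y1 := e1 T
    have y2 := e2 T
    have : 2 * (T ∩ A).card + (if i ∈ T then 1 else 0) + (if k ∈ T then 1 else 0)
      ≤ 2 * (S ∩ A).card + (if i ∈ S then 1 else 0) + (if k ∈ S then 1 else 0) := by
      simp only [hiS, hkS, if_true]
      by_cases c1 : i ∈ T <;> by_cases c2 : k ∈ T <;> simp only [c1, c2, if_true, if_false] at y1 y2 ⊢ <;> omega
    have h : ((2 * (T ∩ A).card + (if i ∈ T then 1 else 0) + (if k ∈ T then 1 else 0) : ℕ) : ℝ)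
      ≤ ((2 * (S ∩ A).card + (if i ∈ S then 1 else 0) + (if k ∈ S then 1 else 0) : ℕ) : ℝ) := by
      exact_mod_cast this
    push_cast at h
    linarith)
  have hk'' : k ∈ S'' := hin k hkS (by simp [q', q''])
  obtain ⟨SA, hSA', hSAc⟩ := rk_attain hne A
  have h5 := hm SA hSA'
  rw [s2, s2] at h5
  have h6 : 2 * (SA ∩ A).card + (if k ∈ SA then 1 else 0) ≤
      2 * (S'' ∩ A).card + (if k ∈ S'' then 1 else 0) := by
    have : ((2 * (SA ∩ A).card + (if k ∈ SA then 1 else 0) : ℕ) : ℝ) ≤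
      ((2 * (S'' ∩ A).card + (if k ∈ S'' then 1 else 0) : ℕ) : ℝ) := by
      push_cast; linarith
    exact_mod_cast this
  have x2 := b2 S'' hS''
  have y2 := e2 S''
  have z2 := b2 SA hSA'
  have w2 := e2 SA
  simp only [hk'', if_true] at y2 h6
  by_cases c : k ∈ SA <;> simp only [c, if_true, if_false] at w2 h6 <;> omega

theorem rk_marg {M : Type} [Fintype M] {D : Finset M → Prop} (hD : GSfam D) (hne : ∃ S, D S)
    (A B : Finset M) (i : M) (hAB : A ⊆ B) :
    rk D (insert i B) + rk D A ≤ rk D (insert i A) + rk D B := by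
  by_cases hA : rk D (insert i A) = rk D A
  · have : rk D (insert i B) = rk D B := by
      have : ∀ C : Finset M, rk D (insert i (A ∪ C)) = rk D (A ∪ C) := by
        intro C
        induction C using Finset.induction_on with
        | empty => simpa using hA
        | insert k C hk ih =>
          rw [union_insert]
          by_cases hkA : k ∈ A ∪ C
          · rw [insert_eq_of_mem hkA]; exact ih
          by_cases hi : i ∈ insert k (A ∪ C)
          · rw [insert_eq_of_mem hi]
          have hi' : i ∉ A ∪ C := fun h => hi (mem_insert_of_mem h)
          have hik : i ≠ k := fun h => hi (by simp [h])
          by_cases h2 : rk D (insert k (A ∪ C)) = rk D (A ∪ C)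
          · rw [rk_local hD hne (A ∪ C) i k hi' hkA hik ih h2, h2]
          · have a1 := rk_insert_le D (insert i (A ∪ C)) k
            have a2 := rk_insert_le D (A ∪ C) k
            have a3 : rk D (A ∪ C) ≤ rk D (insert k (A ∪ C)) := rk_mono D (subset_insert _ _)
            have a4 : rk D (insert k (A ∪ C)) ≤ rk D (insert i (insert k (A ∪ C))) :=
              rk_mono D (subset_insert _ _)
            rw [insert_comm k i] at a1
            omega
      have h := this B
      rwa [union_eq_right.2 hAB] at h
    omega
  · have a1 := rk_insert_le D A i
    have a2 := rk_insert_le D B i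
    have a3 : rk D A ≤ rk D (insert i A) := rk_mono D (subset_insert _ _)
    omega

theorem rk_submod {M : Type} [Fintype M] {D : Finset M → Prop} (hD : GSfam D) (hne : ∃ S, D S)
    (X Y : Finset M) : rk D (X ∪ Y) + rk D (X ∩ Y) ≤ rk D X + rk D Y := by
  have : ∀ C : Finset M, ∀ A B : Finset M, A ⊆ B →
      rk D (B ∪ C) + rk D A ≤ rk D (A ∪ C) + rk D B := by
    intro C
    induction C using Finset.induction_on with
    | empty => intro A B _; simp; omega
    | insert k C hk ih =>
      intro A B hAB
      have h1 := ih A B hAB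
      have h2 := rk_marg hD hne (A ∪ C) (B ∪ C) k (union_subset_union_left hAB)
      rw [union_insert, union_insert]
      omega
  have h := this Y (X ∩ Y) X inter_subset_left
  rw [union_eq_right.2 inter_subset_right] at h
  omega

/-- greedy basis along a weight -/
theorem rk_greedy {M : Type} [Fintype M] {D : Finset M → Prop} (hD : GSfam D) (hne : ∃ S, D S)
    (w : M → ℕ) (X : Finset M) :
    ∃ T ⊆ X, rk D T = T.card ∧
      ∀ c, (T.filter (fun i => c ≤ w i)).card = rk D (X.filter (fun i => c ≤ w i)) := by
  induction X using Finset.induction_on_min_value w with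
  | empty =>
    have h0 : rk D ∅ = 0 := by simp [rk]
    exact ⟨∅, Subset.rfl, by simp [h0], by simp [h0]⟩
  | insert a X ha hmin ih =>
    obtain ⟨T, hT, hTr, hc⟩ := ih
    have hXcard : T.card = rk D X := by
      have := hc 0
      simpa using this
    have hall : ∀ c, c ≤ w a → X.filter (fun i => c ≤ w i) = X := fun c hcw =>
      filter_true_of_mem fun i hi => hcw.trans (hmin i hi)
    have hallT : ∀ c, c ≤ w a → T.filter (fun i => c ≤ w i) = T := fun c hcw =>
      filter_true_of_mem fun i hi => hcw.trans (hmin i (hT hi))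
    by_cases h : rk D (insert a X) = rk D X
    · refine ⟨T, hT.trans (subset_insert _ _), hTr, fun c => ?_⟩
      rw [filter_insert]
      split_ifs with hcw
      · rw [hall c hcw, hallT c hcw, h, hXcard]
      · exact hc c
    · have haT : a ∉ T := fun h => ha (hT h)
      have h1 := rk_marg hD hne T X a hT
      have h2 := rk_insert_le D X a
      have h3 : rk D X ≤ rk D (insert a X) := rk_mono D (subset_insert _ _)
      have h4 := rk_insert_le D T a
      refine ⟨insert a T, insert_subset_insert _ hT, ?_, fun c => ?_⟩
      · rw [card_insert_of_notMem haT]; omega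
      · rw [filter_insert, filter_insert]
        split_ifs with hcw
        · rw [hall c hcw, hallT c hcw, card_insert_of_notMem haT]; omega
        · exact hc c

theorem rk_indep {M : Type} [Fintype M] {D : Finset M → Prop} (hne : ∃ S, D S)
    (T : Finset M) (h : rk D T = T.card) : ∃ S, D S ∧ T ⊆ S := by
  obtain ⟨S, hS, hc⟩ := rk_attain hne T
  refine ⟨S, hS, ?_⟩
  have : S ∩ T = T := eq_of_subset_of_card_le inter_subset_right (by omega)
  exact inter_eq_right.1 this

theorem aux_round {M J K : Type} [Fintype M] [Fintype J] [Fintype K] (κ : M → K)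
    (r : J → Finset M → ℕ) (hmono : ∀ j X Y, X ⊆ Y → r j X ≤ r j Y)
    (hsub : ∀ j X Y, r j (X ∪ Y) + r j (X ∩ Y) ≤ r j X + r j Y)
    (y : J → M → ℝ) (hy : ∀ j i, 0 ≤ y j i) (hyr : ∀ j X, ∑ i ∈ X, y j i ≤ r j X)
    (hcap : ∀ i, ∑ j, y j i ≤ 4) :
    ∃ F : J → Finset M,
      (∀ j k, ⌊∑ i ∈ univ.filter (fun i => κ i = k), y j i⌋₊ ≤
        r j ((F j).filter (fun i => κ i = k))) ∧
      ∀ i, (univ.filter (fun j => i ∈ F j)).card ≤ 4 := by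
  let m : J × K → ℕ := fun l => ⌊∑ i ∈ univ.filter (fun i => κ i = l.2), y l.1 i⌋₊
  let pr : K → Finset (M × Fin 4) → Finset M := fun k X =>
    (X.image Prod.fst).filter (fun i => κ i = k)
  let f : J × K → Finset (M × Fin 4) → ℕ := fun l X => min (m l) (r l.1 (pr l.2 X))
  have hpr : ∀ k X Y, X ⊆ Y → pr k X ⊆ pr k Y := fun k X Y h =>
    filter_subset_filter _ (image_subset_image h)
  have hfm : ∀ l X Y, X ⊆ Y → f l X ≤ f l Y := fun l X Y h =>
    min_le_min le_rfl (hmono _ _ _ (hpr _ _ _ h))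
  obtain ⟨F, hF, hdis⟩ := aux_transversal f m hfm (by
      intro l X Y
      have h1 := hsub l.1 (pr l.2 X) (pr l.2 Y)
      have h2 : pr l.2 (X ∪ Y) = pr l.2 X ∪ pr l.2 Y := by
        simp only [pr, image_union, filter_union]
      have h3 : r l.1 (pr l.2 (X ∩ Y)) ≤ r l.1 (pr l.2 X ∩ pr l.2 Y) :=
        hmono _ _ _ (subset_inter (hpr _ _ _ inter_subset_left) (hpr _ _ _ inter_subset_right))
      have h4 : r l.1 (pr l.2 X) ≤ r l.1 (pr l.2 X ∪ pr l.2 Y) := hmono _ _ _ subset_union_left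
      have h5 : r l.1 (pr l.2 Y) ≤ r l.1 (pr l.2 X ∪ pr l.2 Y) := hmono _ _ _ subset_union_right
      have h6 : r l.1 (pr l.2 (X ∩ Y)) ≤ r l.1 (pr l.2 X) := hmono _ _ _ (hpr _ _ _ inter_subset_left)
      have h7 : r l.1 (pr l.2 (X ∩ Y)) ≤ r l.1 (pr l.2 Y) := hmono _ _ _ (hpr _ _ _ inter_subset_right)
      simp only [f, h2]
      simp only [min_def]
      split_ifs <;> omega)
    (fun l X => min_le_left _ _) (by
      intro I
      set I0 := I.image Prod.fst with hI0
      have hc : 4 * (univ \ I0).card ≤ (univ \ I).card := by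
        have h1 : (univ \ I0) ×ˢ (univ : Finset (Fin 4)) ⊆ univ \ I := by
          intro a ha
          simp only [mem_product, mem_sdiff, mem_univ, true_and, and_true, hI0, mem_image,
            not_exists, not_and] at ha ⊢
          intro h
          exact ha a h rfl
        have := card_le_card h1
        rw [card_product] at this
        simp at this
        simp
        omega
      have h1 : ∀ l : J × K, (m l : ℝ) ≤ f l I +
          ∑ i ∈ (univ \ I0).filter (fun i => κ i = l.2), y l.1 i := by
        intro l
        have hnn : 0 ≤ ∑ i ∈ (univ \ I0).filter (fun i => κ i = l.2), y l.1 i :=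
          sum_nonneg fun i _ => hy _ _
        rcases le_total (m l) (r l.1 (pr l.2 I)) with h | h
        · simp only [f, min_eq_left h]; linarith
        · simp only [f, min_eq_right h]
          have h2 := hyr l.1 (pr l.2 I)
          have h3 : (m l : ℝ) ≤ ∑ i ∈ univ.filter (fun i => κ i = l.2), y l.1 i :=
            Nat.floor_le (sum_nonneg fun i _ => hy _ _)
          have h4 : ∑ i ∈ univ.filter (fun i => κ i = l.2), y l.1 i =
              ∑ i ∈ (univ \ I0).filter (fun i => κ i = l.2), y l.1 i +
              ∑ i ∈ pr l.2 I, y l.1 i := by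
            rw [← sum_union]
            · congr 1
              ext a
              simp only [pr, ← hI0, mem_filter, mem_univ, true_and, mem_union, mem_sdiff]
              tauto
            · rw [disjoint_left]
              intro a
              simp only [pr, ← hI0, mem_filter, mem_univ, true_and, mem_sdiff]
              tauto
          linarith
      have h2 : ∑ l : J × K, ∑ i ∈ (univ \ I0).filter (fun i => κ i = l.2), y l.1 i
          ≤ 4 * (univ \ I0).card := by
        rw [Fintype.sum_prod_type]
        have : ∀ j, ∑ k, ∑ i ∈ (univ \ I0).filter (fun i => κ i = k), y j i =
            ∑ i ∈ univ \ I0, y j i := fun j =>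
          sum_fiberwise _ _ _
        simp only [this]
        rw [sum_comm]
        calc _ ≤ ∑ i ∈ univ \ I0, (4:ℝ) := sum_le_sum fun i _ => hcap i
          _ = _ := by rw [sum_const, nsmul_eq_mul]; ring
      have h3 : ((∑ l, m l : ℕ) : ℝ) ≤ ((∑ l, f l I + 4 * (univ \ I0).card : ℕ) : ℝ) := by
        push_cast
        calc _ ≤ ∑ l : J × K, ((f l I : ℝ) +
          ∑ i ∈ (univ \ I0).filter (fun i => κ i = l.2), y l.1 i) := sum_le_sum fun l _ => h1 l
          _ ≤ _ := by rw [sum_add_distrib]; linarith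
      have h4 : ∑ l, m l ≤ ∑ l, f l I + 4 * (univ \ I0).card := by exact_mod_cast h3
      omega)
  refine ⟨fun j => univ.filter (fun i => ∃ c : Fin 4, (i, c) ∈ F (j, κ i)), ?_, ?_⟩
  · intro j k
    have h1 : m (j, k) ≤ r j (pr k (F (j, k))) := (hF (j, k)).trans (min_le_right _ _)
    refine h1.trans (hmono _ _ _ ?_)
    intro i
    simp only [pr, mem_filter, mem_image, mem_univ, true_and, Prod.exists]
    rintro ⟨⟨a, c, h, rfl⟩, rfl⟩
    exact ⟨⟨c, h⟩, rfl⟩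
  · intro i
    have : ∀ j : J, ∃ c : Fin 4, (∃ c : Fin 4, (i, c) ∈ F (j, κ i)) → (i, c) ∈ F (j, κ i) := by
      intro j
      by_cases h : ∃ c : Fin 4, (i, c) ∈ F (j, κ i)
      · obtain ⟨c, hc⟩ := h; exact ⟨c, fun _ => hc⟩
      · exact ⟨0, fun h' => absurd h' h⟩
    choose c hc using this
    have h := card_le_card_of_injOn (s := univ.filter (fun j => i ∈ univ.filter (fun i => ∃ c : Fin 4, (i, c) ∈ F (j, κ i)))) (t := (univ : Finset (Fin 4))) c (fun _ _ => mem_coe.2 (mem_univ _)) (by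
      intro j hj j' hj' hcc
      simp only [coe_filter, mem_filter, mem_univ, true_and, Set.mem_ofPred_eq] at hj hj'
      have a1 := hc j hj
      have a2 := hc j' hj'
      rw [← hcc] at a2
      exact (Prod.ext_iff.1 (hdis _ _ _ a1 a2)).1)
    simpa using h

theorem aux_geom (B : ℝ) (hB : 0 ≤ B) (N : ℕ) :
    ∑ k ∈ range N, (if (2:ℝ) ^ k ≤ B then (2:ℝ) ^ k else 0) ≤ 2 * B ∧
    ∑ k ∈ range N, (if (2:ℝ) ^ k ≤ B then (2:ℝ) ^ k else 0) ≤ 2 ^ N := by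
  induction N with
  | zero => simp [hB]
  | succ n ih =>
    rw [sum_range_succ, pow_succ]
    have : (0:ℝ) < 2 ^ n := by positivity
    split_ifs with h
    · constructor <;> linarith [ih.1, ih.2]
    · constructor <;> linarith [ih.1, ih.2]

theorem aux_final {M : Type} [Fintype M] (mu y : M → ℝ) (κ : M → ℕ) (N : ℕ) (hN : ∀ i, κ i < N)
    (B : ℝ) (hB : 0 ≤ B) (hy : ∀ i, 0 ≤ y i) (hyB : ∀ i, y i ≠ 0 → mu i ≤ B)
    (h1 : ∀ i, (2:ℝ) ^ κ i ≤ mu i) (h2 : ∀ i, mu i ≤ (2:ℝ) ^ (κ i + 1)) (T : Finset M)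
    (hT : ∀ k, k < N → ⌊∑ i ∈ univ.filter (fun i => κ i = k), y i⌋₊ ≤
      (T.filter (fun i => k ≤ κ i)).card) :
    (∑ i, y i * mu i) / 4 - B ≤ ∑ i ∈ T, mu i := by
  have a1 : ∑ k ∈ range N, (2:ℝ) ^ k / 2 * (T.filter (fun i => k ≤ κ i)).card ≤ ∑ i ∈ T, mu i := by
    have e : ∀ k, (2:ℝ) ^ k / 2 * (T.filter (fun i => k ≤ κ i)).card =
        ∑ i ∈ T, if k ≤ κ i then (2:ℝ) ^ k / 2 else 0 := by
      intro k
      rw [← sum_filter, sum_const, nsmul_eq_mul, mul_comm]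
    simp only [e]
    rw [sum_comm]
    refine sum_le_sum fun i _ => ?_
    rw [← sum_filter]
    have : (range N).filter (fun k => k ≤ κ i) = range (κ i + 1) := by
      ext k
      have := hN i
      simp only [mem_filter, mem_range]
      omega
    rw [this, ← sum_div, geom_sum_eq (by norm_num)]
    have := h1 i
    rw [pow_succ]
    linarith
  have a2 : ∑ k ∈ range N, (2:ℝ) ^ k / 2 * ((∑ i ∈ univ.filter (fun i => κ i = k), y i) -
      (if (2:ℝ) ^ k ≤ B then 1 else 0)) ≤
      ∑ k ∈ range N, (2:ℝ) ^ k / 2 * (T.filter (fun i => k ≤ κ i)).card := by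
    refine sum_le_sum fun k hk => ?_
    refine mul_le_mul_of_nonneg_left ?_ (by positivity)
    have hf := hT k (mem_range.1 hk)
    have hf' : ((⌊∑ i ∈ univ.filter (fun i => κ i = k), y i⌋₊ : ℕ) : ℝ) ≤
      (T.filter (fun i => k ≤ κ i)).card := by exact_mod_cast hf
    have hfl := Nat.lt_floor_add_one (∑ i ∈ univ.filter (fun i => κ i = k), y i)
    split_ifs with hkB
    · linarith
    · have : ∑ i ∈ univ.filter (fun i => κ i = k), y i = 0 := by
        refine sum_eq_zero fun i hi => ?_
        by_contra hne
        have := hyB i hne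
        have h3 := h1 i
        rw [(mem_filter.1 hi).2] at h3
        exact hkB (h3.trans this)
      rw [this, sub_zero]
      positivity
  have a3 : ∑ k ∈ range N, (2:ℝ) ^ k / 2 * (∑ i ∈ univ.filter (fun i => κ i = k), y i) =
      ∑ i, y i * 2 ^ κ i / 2 := by
    rw [← sum_fiberwise_of_maps_to (s := univ) (t := range N) (g := κ)
      (fun i _ => mem_range.2 (hN i))]
    refine sum_congr rfl fun k _ => ?_
    rw [mul_sum]
    refine sum_congr rfl fun i hi => ?_
    rw [(mem_filter.1 hi).2]; ring
  have a4 : (∑ i, y i * mu i) / 4 ≤ ∑ i, y i * 2 ^ κ i / 2 := by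
    rw [sum_div]
    refine sum_le_sum fun i _ => ?_
    have := mul_le_mul_of_nonneg_left (h2 i) (hy i)
    rw [pow_succ] at this
    linarith
  have a5 : ∑ k ∈ range N, (2:ℝ) ^ k / 2 * (if (2:ℝ) ^ k ≤ B then 1 else 0) ≤ B := by
    have h := (aux_geom B hB N).1
    have : ∑ k ∈ range N, (2:ℝ) ^ k / 2 * (if (2:ℝ) ^ k ≤ B then 1 else 0) =
      (∑ k ∈ range N, (if (2:ℝ) ^ k ≤ B then (2:ℝ) ^ k else 0)) / 2 := by
      rw [sum_div]
      refine sum_congr rfl fun k _ => ?_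
      split_ifs <;> ring
    linarith
  simp only [mul_sub, sum_sub_distrib] at a2
  linarith

/-- complementary slackness -/
theorem aux_cs {M J : Type} [Fintype M] [Fintype J]
    (g : J → Finset M → ℝ)
    (hgpos : ∀ j (S : Finset M), S.Nonempty → 0 < g j S)
    (C : ℝ) 
    (x : Finset M → J → ℝ) (s : M → ℝ) (lam : J → ℝ) (mu : M → ℝ)
    (hx : GSFeasible g C x s) (hd : GSDFeasible g C lam mu)
    (hobj : ∑ i : M, s i = GSDObj C lam mu)
    (hlam : ∀ j : J, 0 < lam j) :
    (∀ j, ∑ S ∈ univ.filter (fun S : Finset M => S.Nonempty), (2 - (C * g j S)⁻¹) * x S j = 1) ∧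
    ∀ j S, x S j ≠ 0 → (2 * g j S - C⁻¹) * lam j = ∑ i ∈ S, mu i := by
  obtain ⟨hx0, hxe, hs0, hp, hl⟩ := hx
  obtain ⟨-, hmu, hdu⟩ := hd
  have t1 : 0 ≤ ∑ i, mu i * (C - ((∑ j : J, ∑ S ∈ univ.filter (fun S : Finset M => i ∈ S),
      x S j / g j S) + s i)) :=
    sum_nonneg fun i _ => mul_nonneg (by linarith [hmu i]) (by linarith [hl i])
  have t2 : 0 ≤ ∑ i, (mu i - 1) * s i :=
    sum_nonneg fun i _ => mul_nonneg (by linarith [hmu i]) (hs0 i)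
  have n3 : ∀ j ∈ (univ : Finset J), 0 ≤ lam j * (∑ S ∈ univ.filter (fun S : Finset M => S.Nonempty),
      (2 - (C * g j S)⁻¹) * x S j - 1) :=
    fun j _ => mul_nonneg (hlam j).le (by linarith [hp j])
  have n4 : ∀ j ∈ (univ : Finset J), ∀ S ∈ univ.filter (fun S : Finset M => S.Nonempty),
      0 ≤ x S j / g j S * (∑ i ∈ S, mu i - (2 * g j S - C⁻¹) * lam j) := by
    intro j _ S hS
    have hS := (mem_filter.1 hS).2
    exact mul_nonneg (div_nonneg (hx0 S j) (hgpos j S hS).le) (by linarith [hdu j S hS])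
  have n4' := fun j hj => sum_nonneg (n4 j hj)
  have t3 := sum_nonneg n3
  have t4 := sum_nonneg n4'
  have e1 : ∑ i, mu i * ∑ j : J, ∑ S ∈ univ.filter (fun S : Finset M => i ∈ S), x S j / g j S
      = ∑ j, ∑ S ∈ univ.filter (fun S : Finset M => S.Nonempty), x S j / g j S * ∑ i ∈ S, mu i := by
    simp only [mul_sum]
    rw [sum_comm]
    refine sum_congr rfl fun j _ => ?_
    simp only [sum_filter]
    rw [sum_comm]
    refine sum_congr rfl fun S _ => ?_
    split_ifs with hS
    · rw [← sum_filter, filter_mem_eq_inter, univ_inter]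
      exact sum_congr rfl fun i _ => mul_comm _ _
    · rw [not_nonempty_iff_eq_empty] at hS
      subst hS
      simp
  have e2 : ∑ j, lam j * ∑ S ∈ univ.filter (fun S : Finset M => S.Nonempty),
      (2 - (C * g j S)⁻¹) * x S j = ∑ j, ∑ S ∈ univ.filter (fun S : Finset M => S.Nonempty),
        x S j / g j S * ((2 * g j S - C⁻¹) * lam j) := by
    refine sum_congr rfl fun j _ => ?_
    rw [mul_sum]
    refine sum_congr rfl fun S hS => ?_
    have := hgpos j S (mem_filter.1 hS).2
    rw [mul_inv]
    field_simp
  have tot : ∑ i, mu i * (C - ((∑ j : J, ∑ S ∈ univ.filter (fun S : Finset M => i ∈ S),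
      x S j / g j S) + s i)) + ∑ i, (mu i - 1) * s i +
      ∑ j, lam j * (∑ S ∈ univ.filter (fun S : Finset M => S.Nonempty),
      (2 - (C * g j S)⁻¹) * x S j - 1) +
      ∑ j, ∑ S ∈ univ.filter (fun S : Finset M => S.Nonempty),
      x S j / g j S * (∑ i ∈ S, mu i - (2 * g j S - C⁻¹) * lam j) = 0 := by
    simp only [mul_sub, mul_add, sub_mul, sum_sub_distrib, sum_add_distrib, mul_one, one_mul] at e1 e2 ⊢
    rw [e1, e2, hobj, GSDObj]
    rw [← sum_mul]
    ring
  have z3 : ∑ j, lam j * (∑ S ∈ univ.filter (fun S : Finset M => S.Nonempty),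
      (2 - (C * g j S)⁻¹) * x S j - 1) = 0 := by linarith
  have z4 : ∑ j, ∑ S ∈ univ.filter (fun S : Finset M => S.Nonempty),
      x S j / g j S * (∑ i ∈ S, mu i - (2 * g j S - C⁻¹) * lam j) = 0 := by linarith
  constructor
  · intro j
    have := (sum_eq_zero_iff_of_nonneg n3).1 z3 j (mem_univ j)
    rcases mul_eq_zero.1 this with h | h
    · exact absurd h (hlam j).ne'
    · linarith
  · intro j S hxS
    have hS : S.Nonempty := by
      rw [nonempty_iff_ne_empty]
      rintro rfl
      exact hxS (hxe j)
    have h1 := (sum_eq_zero_iff_of_nonneg n4').1 z4 j (mem_univ j)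
    have h2 := (sum_eq_zero_iff_of_nonneg (n4 j (mem_univ j))).1 h1 S (mem_filter.2 ⟨mem_univ _, hS⟩)
    rcases mul_eq_zero.1 h2 with h | h
    · exact absurd h (div_ne_zero hxS (hgpos j S hS).ne')
    · linarith

theorem aux_job {M : Type} [Fintype M] (g : Finset M → ℝ) (hg0 : g ∅ = 0)
    (hgpos : ∀ S : Finset M, S.Nonempty → 0 < g S) (hgM : MnatConcave g)
    (C : ℝ) (hC : 0 < C) (x : Finset M → ℝ) (lam : ℝ) (hlam : 0 < lam) (mu : M → ℝ)
    (hmu : ∀ i, 1 ≤ mu i) (hx0 : ∀ S, 0 ≤ x S) (hxe : x ∅ = 0)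
    (hdu : ∀ S : Finset M, S.Nonempty → (2 * g S - C⁻¹) * lam - ∑ i ∈ S, mu i ≤ 0)
    (hpr : ∑ S ∈ univ.filter (fun S : Finset M => S.Nonempty), (2 - (C * g S)⁻¹) * x S = 1)
    (hcs : ∀ S, x S ≠ 0 → (2 * g S - C⁻¹) * lam = ∑ i ∈ S, mu i)
    (P : Finset M) (hP : ∀ i, i ∈ P ↔ 1 / (16 * C) ≤ g {i})
    (hJ1 : ∑ i ∈ P, ∑ S ∈ univ.filter (fun S : Finset M => i ∈ S), (g {i} / g S) * x S < 1 / 16)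
    (hJ2 : ∑ S ∈ univ.filter (fun S : Finset M => ∑ i ∈ S, mu i / lam ≤ 4 / C), x S < 1 / 8)
    (D : Finset M → Prop) (hD : D = fun S => g S - ∑ i ∈ S, mu i / (2 * lam) = 1 / (2 * C)) :
    ∃ y : M → ℝ, (∃ S, D S) ∧ GSfam D ∧ (∀ S T, D S → T ⊆ S → ∑ i ∈ T, mu i / (2 * lam) ≤ g T) ∧
      (∀ i, 0 ≤ y i) ∧ (∀ i, y i ≤ 4 * ∑ S ∈ univ.filter (fun S : Finset M => i ∈ S), x S / (C * g S)) ∧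
      (∀ X, ∑ i ∈ X, y i ≤ rk D X) ∧ (∀ i, y i ≠ 0 → mu i ≤ lam / (8 * C)) ∧
      5 / (2 * C) * lam ≤ ∑ i, y i * mu i := by
  set p : M → ℝ := fun i => mu i / (2 * lam) with hp
  have hmul : ∀ S : Finset M, ∑ i ∈ S, mu i / (2 * lam) = (∑ i ∈ S, mu i) / (2 * lam) := fun S =>
    (sum_div _ _ _).symm
  have hV : ∀ T, g T - ∑ i ∈ T, p i ≤ 1 / (2 * C) := by
    intro T
    by_cases hT : T.Nonempty
    · have := hdu T hT
      simp only [hp, hmul]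
      have h2 : 1 / (2 * C) = C⁻¹ / 2 := by field_simp
      rw [h2]
      have h3 : g T - C⁻¹ / 2 ≤ (∑ i ∈ T, mu i) / (2 * lam) := by
        rw [le_div_iff₀ (by positivity)]; nlinarith
      linarith
    · rw [not_nonempty_iff_eq_empty] at hT
      subst hT
      simp [hg0]; positivity
  have hsup : ∀ S, x S ≠ 0 → D S := by
    intro S hS
    have := hcs S hS
    have hps : ∑ i ∈ S, p i = (2 * g S - C⁻¹) * lam / (2 * lam) := by rw [this]; exact hmul S
    rw [hD]
    change g S - ∑ i ∈ S, p i = _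
    rw [hps]
    field_simp
    ring
  have hSne : ∀ S, x S ≠ 0 → S.Nonempty := by
    intro S hS
    rw [nonempty_iff_ne_empty]
    rintro rfl
    exact hS hxe
  have hne : ∃ S, D S := by
    by_contra hcon
    have : ∀ S, x S = 0 := fun S => by
      by_contra h
      exact hcon ⟨S, hsup S h⟩
    simp [this] at hpr
  have hGS : GSfam D := by rw [hD]; exact aux_gsfam g hgM p _ hV
  have hsubd : ∀ S T, D S → T ⊆ S → ∑ i ∈ T, mu i / (2 * lam) ≤ g T := by
    intro S T hS hT
    rw [hD] at hS
    exact aux_sub_demand g hgM hg0 p S (fun T => by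
      have := hV T
      exact this.trans hS.ge) T hT
  -- the large sets
  let Q : Finset (Finset M) := univ.filter (fun S => ¬ ∑ i ∈ S, mu i / lam ≤ 4 / C)
  have hQg : ∀ S ∈ Q, x S ≠ 0 → 5 / 2 ≤ C * g S ∧ C * (∑ i ∈ S, p i) = C * g S - 1 / 2 := by
    intro S hS hxS
    have h1 := (mem_filter.1 hS).2
    have h2 := hsup S hxS
    rw [hD] at h2
    have h3 : ∑ i ∈ S, mu i / lam = 2 * ∑ i ∈ S, p i := by
      rw [mul_sum]; refine sum_congr rfl fun i _ => ?_
      simp only [hp]; field_simp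
    rw [h3, not_le, div_lt_iff₀ hC] at h1
    have h4 : C * g S - C * ∑ i ∈ S, p i = 1 / 2 := by
      rw [← mul_sub, h2]; field_simp
    constructor <;> linarith
  have hgnn : ∀ S, 0 ≤ g S := fun S => by
    by_cases h : S.Nonempty
    · exact (hgpos S h).le
    · rw [not_nonempty_iff_eq_empty] at h; rw [h, hg0]
  set A := ∑ S ∈ Q, x S with hA
  set a := ∑ S ∈ Q, x S / (C * g S) with ha
  have hcnn : ∀ S, 0 ≤ x S / (C * g S) := fun S => div_nonneg (hx0 S) (mul_nonneg hC.le (hgnn S))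
  have ha0 : a ≤ 2 / 5 * A := by
    rw [ha, hA, mul_sum]
    refine sum_le_sum fun S hS => ?_
    by_cases h : x S = 0
    · simp [h]
    · have := (hQg S hS h).1
      rw [div_le_iff₀ (by linarith)]
      nlinarith [hx0 S]
  have hfull : ∑ S : Finset M, (2 * x S - x S / (C * g S)) = 1 := by
    rw [← hpr, sum_filter]
    refine sum_congr rfl fun S _ => ?_
    split_ifs with h
    · rw [div_eq_mul_inv]; ring
    · rw [not_nonempty_iff_eq_empty] at h
      subst h; simp [hxe]
  have hsplit := sum_filter_add_sum_filter_not (univ : Finset (Finset M))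
    (fun S => ∑ i ∈ S, mu i / lam ≤ 4 / C) (fun S => 2 * x S - x S / (C * g S))
  rw [hfull] at hsplit
  have hQsum : ∑ S ∈ Q, (2 * x S - x S / (C * g S)) = 2 * A - a := by
    rw [sum_sub_distrib, ← mul_sum]
  change _ + ∑ S ∈ Q, (2 * x S - x S / (C * g S)) = 1 at hsplit
  rw [hQsum] at hsplit
  have hlow : 0 ≤ ∑ S ∈ univ.filter (fun S : Finset M => ∑ i ∈ S, mu i / lam ≤ 4 / C),
      (2 * x S - x S / (C * g S)) := by
    refine sum_nonneg fun S _ => ?_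
    by_cases h : x S = 0
    · simp [h]
    · have h2 := hsup S h
      rw [hD] at h2
      have h5 : 0 ≤ ∑ i ∈ S, mu i / (2 * lam) :=
        sum_nonneg fun i _ => div_nonneg (by linarith [hmu i]) (by positivity)
      have h4 : C * g S - C * ∑ i ∈ S, mu i / (2 * lam) = 1 / 2 := by
        rw [← mul_sub, h2]; field_simp
      have h6 : 1 / 2 ≤ C * g S := by nlinarith [mul_nonneg hC.le h5]
      have : x S / (C * g S) ≤ 2 * x S := by
        rw [div_le_iff₀ (by linarith)]
        nlinarith [hx0 S]
      linarith
  have hupp : ∑ S ∈ univ.filter (fun S : Finset M => ∑ i ∈ S, mu i / lam ≤ 4 / C),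
      (2 * x S - x S / (C * g S)) ≤ 2 * (1 / 8) := by
    calc _ ≤ ∑ S ∈ univ.filter (fun S : Finset M => ∑ i ∈ S, mu i / lam ≤ 4 / C), 2 * x S :=
          sum_le_sum fun S _ => by linarith [hcnn S]
      _ ≤ _ := by rw [← mul_sum]; linarith
  have ha4 : a ≤ 1 / 4 := by linarith
  have hAa : 3 / 8 ≤ A - a / 2 := by linarith
  let z : M → ℝ := fun i => ∑ S ∈ Q.filter (fun S => i ∈ S), x S / (C * g S)
  have hz0 : ∀ i, 0 ≤ z i := fun i => sum_nonneg fun S _ => hcnn S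
  have hzsum : ∀ (X : Finset M) (w : M → ℝ), ∑ i ∈ X, z i * w i =
      ∑ S ∈ Q, x S / (C * g S) * ∑ i ∈ S ∩ X, w i := by
    intro X w
    simp only [z, sum_mul, sum_filter, ite_mul, zero_mul]
    rw [sum_comm]
    refine sum_congr rfl fun S _ => ?_
    rw [← sum_filter, filter_mem_eq_inter, mul_sum, inter_comm]
  refine ⟨fun i => if i ∈ P then 0 else 4 * z i, hne, hGS, hsubd, ?_, ?_, ?_, ?_, ?_⟩
  · intro i
    have := hz0 i
    simp only
    split_ifs <;> linarith
  · intro i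
    have h1 : z i ≤ ∑ S ∈ univ.filter (fun S : Finset M => i ∈ S), x S / (C * g S) :=
      sum_le_sum_of_subset_of_nonneg (filter_subset_filter _ (subset_univ _)) fun S _ _ => hcnn S
    have := hz0 i
    simp only
    split_ifs <;> linarith
  · intro X
    have h1 : ∑ i ∈ X, z i ≤ a * rk D X := by
      have := hzsum X (fun _ => 1)
      simp only [mul_one, sum_const, nsmul_eq_mul] at this
      rw [this, ha, sum_mul]
      refine sum_le_sum fun S _ => ?_
      by_cases h : x S = 0
      · simp [h]
      · refine mul_le_mul_of_nonneg_left ?_ (hcnn S)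
        exact_mod_cast rk_ge X (hsup S h)
    have h2 : ∑ i ∈ X, (if i ∈ P then 0 else 4 * z i) ≤ 4 * ∑ i ∈ X, z i := by
      rw [mul_sum]
      refine sum_le_sum fun i _ => ?_
      have := hz0 i
      split_ifs <;> linarith
    have h3 : (0:ℝ) ≤ rk D X := by positivity
    nlinarith
  · intro i hi
    simp only [ne_eq, ite_eq_left_iff, not_forall] at hi
    obtain ⟨hiP, hzi⟩ := hi
    have : ∃ S, x S ≠ 0 ∧ i ∈ S := by
      by_contra hcon
      push Not at hcon
      apply hzi
      have : z i = 0 := sum_eq_zero fun S hS => by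
        by_cases h : x S = 0
        · simp [h]
        · exact absurd (mem_filter.1 hS).2 (hcon S h)
      rw [this]; simp
    obtain ⟨S, hS, hiS⟩ := this
    have h1 := hsubd S {i} (hsup S hS) (by simpa using hiS)
    rw [hP, not_le] at hiP
    rw [sum_singleton] at h1
    have h2 := h1.trans hiP.le
    rw [div_le_div_iff₀ (by positivity) (by positivity)] at h2
    rw [le_div_iff₀ (by positivity)]
    nlinarith
  · have h1 : ∑ i, (if i ∈ P then 0 else 4 * z i) * mu i =
        8 * lam * (∑ i, z i * p i - ∑ i ∈ P, z i * p i) := by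
      have : ∑ i, z i * p i = ∑ i, (if i ∈ P then 0 else z i * p i) + ∑ i ∈ P, z i * p i := by
        rw [← sum_filter_not_add_sum_filter univ (fun i => i ∈ P) (fun i => z i * p i)]
        rw [sum_filter, filter_mem_eq_inter, univ_inter]
        congr 1
        refine sum_congr rfl fun i _ => ?_
        by_cases h : i ∈ P <;> simp [h]
      rw [this, add_sub_cancel_right, mul_sum]
      refine sum_congr rfl fun i _ => ?_
      split_ifs
      · simp
      · simp only [hp]; field_simp; ring
    have h2 : C * ∑ i, z i * p i = A - a / 2 := by
      rw [hzsum univ p, hA, ha, mul_sum, sum_div, ← sum_sub_distrib]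
      refine sum_congr rfl fun S hS => ?_
      rw [inter_univ]
      by_cases h : x S = 0
      · simp [h]
      · have h3 := hQg S hS h
        have h4 : C * (x S / (C * g S) * ∑ i ∈ S, p i) = x S / (C * g S) * (C * ∑ i ∈ S, p i) := by
          ring
        rw [h4, h3.2]
        have : C * g S ≠ 0 := by linarith [h3.1]
        rw [mul_sub, div_mul_cancel₀ _ this]
        ring
    have h3 : C * ∑ i ∈ P, z i * p i ≤ 1 / 16 := by
      refine le_trans ?_ hJ1.le
      rw [mul_sum]
      refine sum_le_sum fun i _ => ?_
      have : C * (z i * p i) = ∑ S ∈ Q.filter (fun S => i ∈ S), C * (x S / (C * g S)) * p i := by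
        simp only [z]
        rw [sum_mul, mul_sum]
        exact sum_congr rfl fun S _ => by ring
      rw [this]
      have hnn : ∀ S, 0 ≤ g {i} / g S * x S := fun S =>
        mul_nonneg (div_nonneg (hgnn _) (hgnn _)) (hx0 S)
      refine le_trans (sum_le_sum fun S hS => ?_)
        (sum_le_sum_of_subset_of_nonneg (filter_subset_filter (fun S => i ∈ S) (subset_univ Q))
          fun S _ _ => hnn S)
      by_cases h : x S = 0
      · simp [h]
      · have h5 := hsubd S {i} (hsup S h) (by simpa using (mem_filter.1 hS).2)
        rw [sum_singleton] at h5
        have h6 := hgpos S (hSne S h)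
        have h7 : C * (x S / (C * g S)) = x S / g S := by field_simp
        rw [h7]
        calc x S / g S * p i ≤ x S / g S * g {i} :=
              mul_le_mul_of_nonneg_left h5 (div_nonneg (hx0 S) h6.le)
          _ = _ := by ring
    rw [h1]
    have h4 : 5 / 16 / C ≤ ∑ i, z i * p i - ∑ i ∈ P, z i * p i := by
      rw [div_le_iff₀ hC]; linarith
    calc 5 / (2 * C) * lam = 8 * lam * (5 / 16 / C) := by field_simp; norm_num
      _ ≤ _ := mul_le_mul_of_nonneg_left h4 (by positivity)

/-- Step 3 (Lemma 7, existential content): for M♮-concave speeds and optimal primal-dual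
solutions of (GS)/(GS-D), there is an assignment of the jobs in `J_3 = J ∖ (J_1 ∪ J_2)`
in which every job `j ∈ J_3` gets a nonempty machine set of speed at least `69/(320 C)`
and every machine is used by at most `26` of these jobs (hence the load is at most
`121 C`). -/
theorem step3_high_speed_assignment (M J : Type) [Fintype M] [Fintype J]
    (g : J → Finset M → ℝ)
    (hg0 : ∀ j, g j ∅ = 0)
    (hgpos : ∀ j (S : Finset M), S.Nonempty → 0 < g j S)
    (hgM : ∀ j, MnatConcave (g j))
    (C : ℝ) (hC : 0 < C)
    (x : Finset M → J → ℝ) (s : M → ℝ) (lam : J → ℝ) (mu : M → ℝ)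
    (hx : GSFeasible g C x s) (hd : GSDFeasible g C lam mu)
    (hobj : ∑ i : M, s i = GSDObj C lam mu)
    (hlam : ∀ j : J, 0 < lam j) :
    ∃ S : J → Finset M,
      (∀ j ∈ Finset.univ \ (J1 g C x ∪ J2 g C x lam mu),
        (S j).Nonempty ∧ 69 / (320 * C) ≤ g j (S j)) ∧
      ∀ i : M,
        ((Finset.univ \ (J1 g C x ∪ J2 g C x lam mu)).filter (fun j => i ∈ S j)).card
          ≤ 26 := by
  obtain ⟨hcs1, hcs2⟩ := aux_cs g hgpos C x s lam mu hx hd hobj hlam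
  obtain ⟨hx0, hxe, hs0, -, hl⟩ := hx
  obtain ⟨-, hmu, hdu⟩ := hd
  set J3 : Finset J := Finset.univ \ (J1 g C x ∪ J2 g C x lam mu) with hJ3
  let D : J → Finset M → Prop := fun j S =>
    g j S - ∑ i ∈ S, mu i / (2 * lam j) = 1 / (2 * C)
  have hjob := fun j : {j // j ∈ J3} => aux_job (g j) (hg0 j) (hgpos j) (hgM j) C hC
    (fun S => x S j) (lam j) (hlam j) mu hmu (fun S => hx0 S j) (hxe j) (hdu j) (hcs1 j) (hcs2 j)
    (Mplus g C j) (by intro i; simp [Mplus])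
    (by
      have h := j.2
      simp only [hJ3, mem_sdiff, mem_univ, true_and, mem_union, not_or] at h
      have h1 := h.1
      simp only [J1, mem_filter, mem_univ, true_and, not_le] at h1
      exact h1)
    (by
      have h := j.2
      simp only [hJ3, mem_sdiff, mem_univ, true_and, mem_union, not_or] at h
      have h2 := h.2
      simp only [J2, mem_filter, mem_sdiff, mem_univ, true_and, not_and, not_le] at h2
      exact h2 h.1)
    (D j) rfl
  choose y hne hGS hsubd hy0 hyc hyr hyB hyW using hjob
  have hκ : ∀ i, ∃ n : ℕ, (2:ℝ) ^ n ≤ mu i ∧ mu i < (2:ℝ) ^ (n + 1) := fun i =>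
    exists_nat_pow_near (hmu i) (by norm_num)
  choose κ hκ1 hκ2 using hκ
  let N := univ.sup κ + 1
  have hN : ∀ i, κ i < N := fun i => Nat.lt_succ_of_le (le_sup (mem_univ i))
  obtain ⟨F, hF, hcard⟩ := aux_round (fun i => (⟨κ i, hN i⟩ : Fin N))
    (fun j : {j // j ∈ J3} => rk (D j)) (fun j X Y h => rk_mono _ h)
    (fun j X Y => rk_submod (hGS j) (hne j) X Y) y hy0 hyr (by
      intro i
      have hnn : ∀ j, 0 ≤ ∑ S ∈ univ.filter (fun S : Finset M => i ∈ S), x S j / g j S := by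
        intro j
        refine sum_nonneg fun S hS => div_nonneg (hx0 S j) ?_
        exact (hgpos j S ⟨i, (mem_filter.1 hS).2⟩).le
      have h1 : ∑ j : {j // j ∈ J3}, y j i ≤ ∑ j : {j // j ∈ J3}, 4 / C *
          ∑ S ∈ univ.filter (fun S : Finset M => i ∈ S), x S j / g j S := by
        refine sum_le_sum fun j _ => (hyc j i).trans_eq ?_
        rw [mul_sum, mul_sum]
        refine sum_congr rfl fun S _ => ?_
        rw [mul_comm C, ← div_div]
        ring
      refine h1.trans ?_
      rw [← mul_sum, sum_coe_sort J3 (fun j => ∑ S ∈ univ.filter (fun S : Finset M => i ∈ S),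
        x S j / g j S)]
      have h2 : ∑ j ∈ J3, ∑ S ∈ univ.filter (fun S : Finset M => i ∈ S), x S j / g j S ≤ C := by
        refine (sum_le_sum_of_subset_of_nonneg (subset_univ J3) fun j _ _ => hnn j).trans ?_
        linarith [hl i, hs0 i]
      calc 4 / C * _ ≤ 4 / C * C := mul_le_mul_of_nonneg_left h2 (by positivity)
        _ = 4 := by field_simp)
  have hT : ∀ j : {j // j ∈ J3}, ∃ T ⊆ F j, 69 / (320 * C) ≤ g j T := by
    intro j
    obtain ⟨T, hTF, hTr, hTc⟩ := rk_greedy (hGS j) (hne j) κ (F j)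
    refine ⟨T, hTF, ?_⟩
    obtain ⟨S, hS, hTS⟩ := rk_indep (hne j) T hTr
    have h1 := hsubd j S T hS hTS
    have hl := hlam j
    have h2 := aux_final mu (y j) κ N hN (lam j / (8 * C)) (by positivity) (hy0 j) (hyB j) hκ1
      (fun i => (hκ2 i).le) T (by
        intro k hk
        rw [hTc]
        have h3 := hF j ⟨k, hk⟩
        simp only [Fin.mk.injEq] at h3
        refine h3.trans (rk_mono _ ?_)
        intro i
        simp only [mem_filter]
        rintro ⟨h, rfl⟩
        exact ⟨h, le_rfl⟩)
    have h3 := hyW j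
    refine le_trans ?_ h1
    rw [← sum_div, le_div_iff₀ (by positivity)]
    have h4 : 69 / (320 * C) * (2 * lam j) ≤ 5 / (2 * C) * lam j / 4 - lam j / (8 * C) := by
      have : 5 / (2 * C) * lam j / 4 - lam j / (8 * C) - 69 / (320 * C) * (2 * lam j) =
        11 / 160 * (lam j / C) := by field_simp; norm_num
      have h5 : 0 ≤ lam j / C := by positivity
      linarith
    linarith
  choose T hTF hTg using hT
  refine ⟨fun j => if h : j ∈ J3 then T ⟨j, h⟩ else ∅, ?_, ?_⟩
  · intro j hj
    simp only [hj, dif_pos]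
    have h := hTg ⟨j, hj⟩
    refine ⟨?_, h⟩
    rw [nonempty_iff_ne_empty]
    intro he
    rw [he, hg0] at h
    have : 0 < 69 / (320 * C) := by positivity
    linarith
  · intro i
    have h1 : (J3.filter (fun j => i ∈ if h : j ∈ J3 then T ⟨j, h⟩ else ∅)) ⊆
        (univ.filter (fun j : {j // j ∈ J3} => i ∈ F j)).image Subtype.val := by
      intro j hj
      obtain ⟨hj, hi⟩ := mem_filter.1 hj
      rw [dif_pos hj] at hi
      exact mem_image.2 ⟨⟨j, hj⟩, mem_filter.2 ⟨mem_univ _, hTF _ hi⟩, rfl⟩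
    have h2 := (card_le_card h1).trans card_image_le
    have h3 := hcard i
    exact (h2.trans h3).trans (by norm_num)
end

section
/- Let every processing speed function g_j be M♮-concave, let (x, s) and (λ, μ) be optimal solutions to (GS) and (GS-D) for target C > 0 (feasible solutions with coinciding objective values, and λ_j > 0 for all j), and let J_3 := J ∖ (J_1 ∪ J_2). Then there exists x' : 2^M × J_3 → ℝ_{≥0} such that, writing x'_{ij} := Σ_{S⊆M : i∈S} x'(S,j): (1) Σ_{S⊆M} x'(S,j) = 1 for all j ∈ J_3; (2) whenever x'(S,j) > 0 one has S ∩ M⁺_j = ∅ and S ∈ F_j; (3) Σ_{j∈J_3} x'_{ij} ≤ 26 for all i ∈ M; and (4) Σ_{i∈M} (μ_i/λ_j)·x'_{ij} ≥ 79/(40C) for all j ∈ J_3. (Lemma 9 / Step 3A.) -/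
open Finset
open scoped Classical

/-- `g*_j(S) = 2 g_j(S) - ∑_{i ∈ S} μ_i / λ_j`. -/
noncomputable def gstar {M J : Type} [Fintype M] (g : J → Finset M → ℝ)
    (lam : J → ℝ) (mu : M → ℝ) (j : J) (S : Finset M) : ℝ :=
  2 * g j S - ∑ i ∈ S, mu i / lam j

/-- `F_j`: the downward closure of the set `D_j` of maximizers of `g*_j`. -/
noncomputable def Fj {M J : Type} [Fintype M] (g : J → Finset M → ℝ)
    (lam : J → ℝ) (mu : M → ℝ) (j : J) : Set (Finset M) :=
  {S : Finset M | ∃ T : Finset M,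
    (∀ T' : Finset M, gstar g lam mu j T' ≤ gstar g lam mu j T) ∧ S ⊆ T}

/-- Exchange of summation over incidences `i ∈ S`. -/
lemma aux_swap {M : Type} [Fintype M] (a : M → ℝ) (f : Finset M → ℝ) :
    ∑ i : M, a i * ∑ S ∈ Finset.univ.filter (fun S : Finset M => i ∈ S), f S
      = ∑ S : Finset M, f S * ∑ i ∈ S, a i := by
  simp_rw [Finset.sum_filter, Finset.mul_sum]
  rw [Finset.sum_comm]
  refine Finset.sum_congr rfl fun S _ => ?_
  rw [← Finset.sum_filter_add_sum_filter_not Finset.univ (fun i => i ∈ S)]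
  rw [Finset.sum_eq_zero (s := Finset.univ.filter (fun i => ¬ i ∈ S))]
  · rw [add_zero, Finset.filter_mem_eq_inter, Finset.univ_inter]
    refine Finset.sum_congr rfl fun i hi => ?_
    rw [if_pos hi]; ring
  · intro i hi
    rw [if_neg (Finset.mem_filter.1 hi).2, mul_zero]

/-- For `M♮`-concave `g` the price of an item in a demanded set is at most its singleton value. -/
lemma aux_price {M : Type} [Fintype M] (g : Finset M → ℝ) (hg0 : g ∅ = 0)
    (hM : MnatConcave g) (p : M → ℝ) (S : Finset M)
    (hS : ∀ T : Finset M, g T - ∑ i ∈ T, p i ≤ g S - ∑ i ∈ S, p i)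
    (i : M) (hi : i ∈ S) : p i ≤ g {i} := by
  -- a price large enough to forbid every other item
  have hpk : ∀ k, |p k| ≤ ∑ k : M, |p k| := fun k =>
    Finset.single_le_sum (f := fun k => |p k|) (fun _ _ => abs_nonneg _) (Finset.mem_univ k)
  obtain ⟨W, hW⟩ := Finite.exists_max (fun T : Finset M => |g T|)
  set K : ℝ := ∑ k : M, |p k| + 2 * |g W| + 1 with hK
  have hK0 : 0 ≤ K := by
    have := hpk i
    have := abs_nonneg (p i)
    have := abs_nonneg (g W)
    linarith
  obtain ⟨T, hT, hTi⟩ := hM p (fun k => if k = i then p k else K) (by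
    intro k
    split_ifs
    · exact le_rfl
    · have := hpk k
      have := le_abs_self (p k)
      have := abs_nonneg (g W)
      linarith) S hS
  have hiT : i ∈ T := hTi i hi (by simp)
  have hsum : ∑ k ∈ T, (if k = i then p k else K) = p i + ∑ k ∈ T.erase i, K := by
    rw [← Finset.add_sum_erase T _ hiT]
    simp only [if_true]
    congr 1
    refine Finset.sum_congr rfl fun k hk => ?_
    rw [if_neg (Finset.ne_of_mem_erase hk)]
  have h0 := hT ∅
  rw [hsum, Finset.sum_empty, hg0] at h0
  by_cases hne : (T.erase i).Nonempty
  · exfalso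
    have h1 : K ≤ ∑ k ∈ T.erase i, K := by
      obtain ⟨k, hk⟩ := hne
      exact Finset.single_le_sum (f := fun _ => K) (fun _ _ => hK0) hk
    have := hW T
    have := le_abs_self (g T)
    have := neg_abs_le (p i)
    have := hpk i
    have := abs_nonneg (g W)
    linarith
  · rw [Finset.not_nonempty_iff_eq_empty] at hne
    have hTe : T = {i} := by
      rw [← Finset.insert_erase hiT, hne]; rfl
    rw [hne, Finset.sum_empty, hTe] at h0
    linarith

/-- Complementary slackness. -/
lemma aux_slack {M J : Type} [Fintype M] [Fintype J]
    (g : J → Finset M → ℝ)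
    (hgpos : ∀ j (S : Finset M), S.Nonempty → 0 < g j S)
    (C : ℝ) (hC : 0 < C)
    (x : Finset M → J → ℝ) (s : M → ℝ) (lam : J → ℝ) (mu : M → ℝ)
    (hx : GSFeasible g C x s) (hd : GSDFeasible g C lam mu)
    (hobj : ∑ i : M, s i = GSDObj C lam mu)
    (hlam : ∀ j : J, 0 < lam j) :
    (∀ j, ∑ S : Finset M, (2 - (C * g j S)⁻¹) * x S j = 1) ∧
    (∀ j (S : Finset M), 0 < x S j → S.Nonempty ∧ ∑ i ∈ S, mu i / lam j = 2 * g j S - C⁻¹) := by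
  obtain ⟨hx0, hxe, hs0, hxj, hxi⟩ := hx
  obtain ⟨-, hmu, hdj⟩ := hd
  have hne : ∀ j (S : Finset M), 0 < x S j → S.Nonempty := by
    intro j S h
    rw [Finset.nonempty_iff_ne_empty]
    rintro rfl
    rw [hxe] at h
    exact lt_irrefl _ h
  have hsumall : ∀ j, ∑ S ∈ Finset.univ.filter (fun S : Finset M => S.Nonempty),
      (2 - (C * g j S)⁻¹) * x S j = ∑ S : Finset M, (2 - (C * g j S)⁻¹) * x S j := by
    intro j
    rw [Finset.sum_filter]
    refine Finset.sum_congr rfl fun S _ => ?_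
    split_ifs with h
    · rfl
    · rw [Finset.not_nonempty_iff_eq_empty] at h
      rw [h, hxe, mul_zero]
  have hA : ∀ j, 0 ≤ lam j * (∑ S : Finset M, (2 - (C * g j S)⁻¹) * x S j - 1) := by
    intro j
    have := hxj j
    rw [hsumall] at this
    exact mul_nonneg (hlam j).le (by linarith)
  have hB : ∀ j (S : Finset M),
      0 ≤ x S j / g j S * ∑ i ∈ S, mu i - lam j * ((2 - (C * g j S)⁻¹) * x S j) := by
    intro j S
    by_cases hS : S.Nonempty
    · have hg := hgpos j S hS
      have h1 := hdj j S hS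
      have : x S j / g j S * ∑ i ∈ S, mu i - lam j * ((2 - (C * g j S)⁻¹) * x S j)
        = x S j / g j S * (∑ i ∈ S, mu i - (2 * g j S - C⁻¹) * lam j) := by
        field_simp
      rw [this]
      exact mul_nonneg (div_nonneg (hx0 _ _) hg.le) (by linarith)
    · rw [Finset.not_nonempty_iff_eq_empty] at hS
      rw [hS, hxe]; simp
  have hload : ∑ i : M, s i ≤ C * ∑ i : M, mu i
      - ∑ j : J, ∑ S : Finset M, x S j / g j S * ∑ i ∈ S, mu i := by
    have h1 : ∀ i, s i ≤ C * mu i - mu i *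
        ∑ j : J, ∑ S ∈ Finset.univ.filter (fun S : Finset M => i ∈ S), x S j / g j S := by
      intro i
      have h2 := hxi i
      have h3 := hmu i
      have h4 := hs0 i
      nlinarith
    refine (Finset.sum_le_sum fun i _ => h1 i).trans (le_of_eq ?_)
    rw [Finset.sum_sub_distrib, ← Finset.mul_sum]
    congr 1
    simp_rw [← aux_swap, Finset.mul_sum (s := (Finset.univ : Finset J))]
    rw [Finset.sum_comm]
  have htot : ∑ j : J, (lam j * (∑ S : Finset M, (2 - (C * g j S)⁻¹) * x S j - 1)
      + ∑ S : Finset M,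
        (x S j / g j S * ∑ i ∈ S, mu i - lam j * ((2 - (C * g j S)⁻¹) * x S j))) ≤ 0 := by
    have : ∀ j, lam j * (∑ S : Finset M, (2 - (C * g j S)⁻¹) * x S j - 1)
      + ∑ S : Finset M,
        (x S j / g j S * ∑ i ∈ S, mu i - lam j * ((2 - (C * g j S)⁻¹) * x S j))
      = ∑ S : Finset M, x S j / g j S * ∑ i ∈ S, mu i - lam j := by
      intro j
      rw [Finset.sum_sub_distrib, ← Finset.mul_sum]
      ring
    simp_rw [this]
    rw [Finset.sum_sub_distrib]
    rw [hobj, GSDObj] at hload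
    linarith
  have hBs : ∀ j, 0 ≤ ∑ S : Finset M,
        (x S j / g j S * ∑ i ∈ S, mu i - lam j * ((2 - (C * g j S)⁻¹) * x S j)) :=
    fun j => Finset.sum_nonneg fun S _ => hB j S
  have hz := (Finset.sum_eq_zero_iff_of_nonneg (fun j _ => add_nonneg (hA j) (hBs j))).1
    (le_antisymm htot (Finset.sum_nonneg fun j _ => add_nonneg (hA j) (hBs j)))
  constructor
  · intro j
    have h1 := hz j (Finset.mem_univ j)
    have h2 : lam j * (∑ S : Finset M, (2 - (C * g j S)⁻¹) * x S j - 1) = 0 :=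
      le_antisymm (by linarith [hBs j]) (hA j)
    rcases mul_eq_zero.1 h2 with h | h
    · exact absurd h (hlam j).ne'
    · linarith
  · intro j S hS
    refine ⟨hne j S hS, ?_⟩
    have h1 := hz j (Finset.mem_univ j)
    have h2 := (Finset.sum_eq_zero_iff_of_nonneg (fun S _ => hB j S)).1
      (le_antisymm (by linarith [hA j]) (hBs j)) S (Finset.mem_univ S)
    have hg := hgpos j S (hne j S hS)
    have hl := hlam j
    have h3 : x S j / g j S * ∑ i ∈ S, mu i - lam j * ((2 - (C * g j S)⁻¹) * x S j)
        = x S j / g j S * (∑ i ∈ S, mu i - (2 * g j S - C⁻¹) * lam j) := by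
        field_simp
    rw [h3] at h2
    have h4 : ∑ i ∈ S, mu i - (2 * g j S - C⁻¹) * lam j = 0 :=
      (mul_eq_zero.1 h2).resolve_left (div_pos hS hg).ne'
    rw [← Finset.sum_div, div_eq_iff hl.ne']
    linarith

/-- Integration against the push-forward of `w` along `φ`, plus the remaining mass at `∅`. -/
lemma aux_push {M : Type} [Fintype M] (w : Finset M → ℝ) (φ : Finset M → Finset M) (r : ℝ)
    (f : Finset M → ℝ) :
    ∑ T : Finset M, ((∑ S : Finset M, if φ S = T then w S else 0) + if T = ∅ then r else 0) * f T
      = ∑ S : Finset M, w S * f (φ S) + r * f ∅ := by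
  simp_rw [add_mul, Finset.sum_add_distrib, Finset.sum_mul]
  rw [Finset.sum_comm]
  simp [ite_mul]

/-- Lemma 9 (Step 3A): for M♮-concave speeds and optimal primal-dual solutions of
(GS)/(GS-D), there is a fractional assignment `x' ≥ 0` of the jobs in
`J_3 = J ∖ (J_1 ∪ J_2)` such that, writing `x'_{ij} = ∑_{S ∋ i} x'(S,j)`:
(1) `∑_S x'(S,j) = 1` for `j ∈ J_3`; (2) `x'(S,j) > 0` implies `S ∩ M⁺_j = ∅` and
`S ∈ F_j`; (3) `∑_{j ∈ J_3} x'_{ij} ≤ 26` for every `i`; and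
(4) `∑_i (μ_i/λ_j) x'_{ij} ≥ 79/(40 C)` for every `j ∈ J_3`. -/
theorem lemma9_split_solution (M J : Type) [Fintype M] [Fintype J]
    (g : J → Finset M → ℝ)
    (hg0 : ∀ j, g j ∅ = 0)
    (hgpos : ∀ j (S : Finset M), S.Nonempty → 0 < g j S)
    (hgM : ∀ j, MnatConcave (g j))
    (C : ℝ) (hC : 0 < C)
    (x : Finset M → J → ℝ) (s : M → ℝ) (lam : J → ℝ) (mu : M → ℝ)
    (hx : GSFeasible g C x s) (hd : GSDFeasible g C lam mu)
    (hobj : ∑ i : M, s i = GSDObj C lam mu)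
    (hlam : ∀ j : J, 0 < lam j) :
    ∃ x' : Finset M → J → ℝ,
      (∀ (S : Finset M) (j : J), 0 ≤ x' S j) ∧
      (∀ j ∈ Finset.univ \ (J1 g C x ∪ J2 g C x lam mu),
        ∑ S : Finset M, x' S j = 1) ∧
      (∀ j ∈ Finset.univ \ (J1 g C x ∪ J2 g C x lam mu), ∀ S : Finset M, 0 < x' S j →
        S ∩ Mplus g C j = ∅ ∧ S ∈ Fj g lam mu j) ∧
      (∀ i : M,
        ∑ j ∈ Finset.univ \ (J1 g C x ∪ J2 g C x lam mu),
          (∑ S ∈ Finset.univ.filter (fun S : Finset M => i ∈ S), x' S j) ≤ 26) ∧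
      (∀ j ∈ Finset.univ \ (J1 g C x ∪ J2 g C x lam mu),
        79 / (40 * C) ≤
          ∑ i : M, (mu i / lam j) *
            ∑ S ∈ Finset.univ.filter (fun S : Finset M => i ∈ S), x' S j) := by
  obtain ⟨htight, hcs⟩ := aux_slack g hgpos C hC x s lam mu hx hd hobj hlam
  obtain ⟨hx0, hxe, hs0, hxj, hxi⟩ := hx
  obtain ⟨-, hmu, hdj⟩ := hd
  have hp0 : ∀ j i, 0 ≤ mu i / lam j := fun j i =>
    div_nonneg (by linarith [hmu i]) (hlam j).le
  have hCi : 0 < C⁻¹ := inv_pos.2 hC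
  -- support sets are maximizers
  have hmax : ∀ j (S : Finset M), 0 < x S j →
      ∀ T, gstar g lam mu j T ≤ gstar g lam mu j S := by
    intro j S hS T
    have h1 : gstar g lam mu j S = C⁻¹ := by
      rw [gstar, (hcs j S hS).2]; ring
    rw [h1]
    by_cases hT : T.Nonempty
    · have h2 := hdj j T hT
      have hl := hlam j
      rw [gstar, ← Finset.sum_div, sub_le_comm, le_div_iff₀ hl]
      linarith
    · rw [Finset.not_nonempty_iff_eq_empty] at hT
      rw [hT, gstar, hg0]
      simpa using hCi.le
  have hprice : ∀ j (S : Finset M), 0 < x S j → ∀ i ∈ S, mu i / lam j ≤ 2 * g j {i} := by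
    intro j S hS i hi
    have := aux_price (g j) (hg0 j) (hgM j) (fun i => mu i / lam j / 2) S (by
      intro T
      have := hmax j S hS T
      rw [gstar, gstar] at this
      rw [← Finset.sum_div (s := T), ← Finset.sum_div (s := S)]
      linarith) i hi
    linarith
  set P : Finset M → J → Prop := fun S j => ∑ i ∈ S, mu i / lam j ≤ 4 / C with hP
  set w : Finset M → J → ℝ := fun S j => if P S j then 0 else 4 / C * (x S j / g j S) with hw
  have hxg : ∀ S j, 0 ≤ x S j / g j S := by
    intro S j
    by_cases hS : S.Nonempty
    · exact div_nonneg (hx0 _ _) (hgpos j S hS).le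
    · rw [Finset.not_nonempty_iff_eq_empty] at hS
      rw [hS, hxe]; simp
  have hw0 : ∀ S j, 0 ≤ w S j := by
    intro S j
    simp only [hw]
    split_ifs
    · exact le_rfl
    · exact mul_nonneg (by positivity) (hxg S j)
  have hwle : ∀ S j, w S j ≤ 4 / C * (x S j / g j S) := by
    intro S j
    simp only [hw]
    split_ifs
    · exact mul_nonneg (by positivity) (hxg S j)
    · exact le_rfl
  have hwx : ∀ S j, 0 < w S j → 0 < x S j ∧ ¬ P S j := by
    intro S j h
    simp only [hw] at h
    split_ifs at h with h'
    · exact absurd h (lt_irrefl _)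
    · refine ⟨lt_of_le_of_ne (hx0 S j) ?_, h'⟩
      intro h0
      rw [← h0] at h
      simp at h
  have hinv : ∀ S j, 4 / C * (x S j / g j S) = 4 * ((C * g j S)⁻¹ * x S j) := by
    intro S j
    rw [mul_inv]; ring
  -- coefficient bounds
  have hcoef : ∀ S j, w S j ≤ (2 - (C * g j S)⁻¹) * x S j := by
    intro S j
    by_cases hxS : 0 < x S j
    · obtain ⟨hne, heq⟩ := hcs j S hxS
      have hg := hgpos j S hne
      have hCg : 0 < C * g j S := mul_pos hC hg
      simp only [hw]
      split_ifs with h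
      · refine mul_nonneg ?_ hxS.le
        have h1 : 0 ≤ ∑ i ∈ S, mu i / lam j := Finset.sum_nonneg fun i _ => hp0 j i
        rw [heq] at h1
        have h2 : (C * g j S)⁻¹ ≤ 2 := by
          rw [inv_le_comm₀ hCg two_pos]
          have : C * (2 * g j S - C⁻¹) = 2 * (C * g j S) - 1 := by field_simp
          have := mul_nonneg hC.le h1
          linarith
        linarith
      · rw [hinv]
        have h1 : 4 / C < 2 * g j S - C⁻¹ := by rw [← heq]; exact not_le.1 h
        have h2 : 5 / 2 ≤ C * g j S := by
          have e : C * (2 * g j S - C⁻¹) = 2 * (C * g j S) - 1 := by field_simp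
          have e2 : C * (4 / C) = 4 := by field_simp
          have := mul_lt_mul_of_pos_left h1 hC
          linarith
        have h3 : (C * g j S)⁻¹ ≤ 2 / 5 := by
          rw [inv_le_comm₀ hCg (by norm_num)]
          linarith
        rw [← mul_assoc]
        exact mul_le_mul_of_nonneg_right (by linarith) hxS.le
    · have : x S j = 0 := le_antisymm (not_lt.1 hxS) (hx0 S j)
      simp [hw, this]
  have hsumw : ∀ j, ∑ S : Finset M, w S j ≤ 1 := by
    intro j
    rw [← htight j]
    exact Finset.sum_le_sum fun S _ => hcoef S j
  refine ⟨fun T j => (∑ S : Finset M, if S \ Mplus g C j = T then w S j else 0)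
    + if T = ∅ then 1 - ∑ S : Finset M, w S j else 0, ?_, ?_, ?_, ?_, ?_⟩
  · intro T j
    refine add_nonneg (Finset.sum_nonneg fun S _ => ?_) ?_
    · split_ifs
      · exact hw0 S j
      · exact le_rfl
    · split_ifs
      · linarith [hsumw j]
      · exact le_rfl
  · intro j _
    have := aux_push (fun S => w S j) (fun S => S \ Mplus g C j)
      (1 - ∑ S : Finset M, w S j) (fun _ => 1)
    simp only [mul_one] at this
    rw [this]; ring
  · intro j _ T hT
    by_cases hTe : T = ∅
    · subst hTe
      refine ⟨Finset.empty_inter _, ?_⟩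
      obtain ⟨U, hU⟩ := Finite.exists_max (gstar g lam mu j)
      exact ⟨U, hU, Finset.empty_subset _⟩
    · simp only [if_neg hTe, add_zero] at hT
      obtain ⟨S, -, hS⟩ := Finset.exists_lt_of_sum_lt
        (f := fun _ : Finset M => (0 : ℝ)) (by simpa using hT)
      split_ifs at hS with h
      · subst h
        exact ⟨Finset.sdiff_inter_self _ _, S, hmax j S (hwx S j hS).1, Finset.sdiff_subset⟩
      · exact absurd hS (lt_irrefl _)
  · intro i
    have hone : ∀ j, (∑ T ∈ Finset.univ.filter (fun T : Finset M => i ∈ T),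
        ((∑ S : Finset M, if S \ Mplus g C j = T then w S j else 0)
          + if T = ∅ then 1 - ∑ S : Finset M, w S j else 0))
        ≤ 4 / C * ∑ S ∈ Finset.univ.filter (fun S : Finset M => i ∈ S), x S j / g j S := by
      intro j
      have h := aux_push (fun S => w S j) (fun S => S \ Mplus g C j)
        (1 - ∑ S : Finset M, w S j) (fun T => if i ∈ T then 1 else 0)
      simp only [mul_ite, mul_one, mul_zero, Finset.notMem_empty, if_false, add_zero] at h
      rw [Finset.sum_filter, h, Finset.mul_sum, Finset.sum_filter]
      refine Finset.sum_le_sum fun S _ => ?_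
      by_cases h1 : i ∈ S \ Mplus g C j
      · rw [if_pos h1, if_pos (Finset.mem_sdiff.1 h1).1]
        exact hwle S j
      · rw [if_neg h1]
        split_ifs
        · exact mul_nonneg (by positivity) (hxg S j)
        · exact le_rfl
    have hnn : ∀ j, 0 ≤ 4 / C * ∑ S ∈ Finset.univ.filter (fun S : Finset M => i ∈ S),
        x S j / g j S := fun j =>
      mul_nonneg (by positivity) (Finset.sum_nonneg fun S _ => hxg S j)
    calc _ ≤ ∑ j ∈ Finset.univ \ (J1 g C x ∪ J2 g C x lam mu), 4 / C *
          ∑ S ∈ Finset.univ.filter (fun S : Finset M => i ∈ S), x S j / g j S :=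
          Finset.sum_le_sum fun j _ => hone j
      _ ≤ ∑ j : J, 4 / C *
          ∑ S ∈ Finset.univ.filter (fun S : Finset M => i ∈ S), x S j / g j S :=
          Finset.sum_le_sum_of_subset_of_nonneg (Finset.subset_univ _) fun j _ _ => hnn j
      _ = 4 / C * ∑ j : J,
          ∑ S ∈ Finset.univ.filter (fun S : Finset M => i ∈ S), x S j / g j S := by
          rw [Finset.mul_sum]
      _ ≤ 4 / C * C := mul_le_mul_of_nonneg_left (by linarith [hxi i, hs0 i]) (by positivity)
      _ = 4 := by field_simp
      _ ≤ 26 := by norm_num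
  · intro j hj
    rw [aux_swap, aux_push]
    simp only [Finset.sum_empty, mul_zero, add_zero]
    have hj1 : j ∉ J1 g C x := fun h => (Finset.mem_sdiff.1 hj).2 (Finset.mem_union_left _ h)
    have hj2 : j ∉ J2 g C x lam mu :=
      fun h => (Finset.mem_sdiff.1 hj).2 (Finset.mem_union_right _ h)
    have hR : ∑ S : Finset M, x S j / g j S * ∑ i ∈ S ∩ Mplus g C j, g j {i} < 1 / 16 := by
      by_contra hcon
      apply hj1
      rw [J1, Finset.mem_filter]
      refine ⟨Finset.mem_univ _, (not_lt.1 hcon).trans (le_of_eq ?_)⟩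
      have h := aux_swap (fun i => if i ∈ Mplus g C j then g j {i} else 0)
        (fun S => x S j / g j S)
      have h2 : ∀ S : Finset M, ∑ i ∈ S, (if i ∈ Mplus g C j then g j {i} else 0)
          = ∑ i ∈ S ∩ Mplus g C j, g j {i} := by
        intro S
        rw [← Finset.sum_filter, Finset.filter_mem_eq_inter]
      simp_rw [h2] at h
      rw [← h]
      simp_rw [ite_mul, zero_mul]
      rw [← Finset.sum_filter, Finset.filter_mem_eq_inter, Finset.univ_inter]
      refine Finset.sum_congr rfl fun i _ => ?_
      rw [Finset.mul_sum]
      refine Finset.sum_congr rfl fun S _ => ?_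
      ring
    have hX2 : ∑ S : Finset M, (if P S j then x S j else 0) < 1 / 8 := by
      by_contra hcon
      apply hj2
      rw [J2, Finset.mem_filter]
      refine ⟨Finset.mem_sdiff.2 ⟨Finset.mem_univ _, hj1⟩, ?_⟩
      rw [Finset.sum_filter]
      exact not_lt.1 hcon
    -- termwise lower bound
    have hterm : ∀ S : Finset M,
        4 / C * ((2 - (C * g j S)⁻¹) * x S j - 8 / 5 * (if P S j then x S j else 0)
          - 2 * (x S j / g j S * ∑ i ∈ S ∩ Mplus g C j, g j {i}))
        ≤ w S j * ∑ i ∈ S \ Mplus g C j, mu i / lam j := by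
      intro S
      by_cases hxS : 0 < x S j
      · obtain ⟨hne, heq⟩ := hcs j S hxS
        have hg := hgpos j S hne
        have hCg : 0 < C * g j S := mul_pos hC hg
        have hG : 0 ≤ ∑ i ∈ S ∩ Mplus g C j, g j {i} :=
          Finset.sum_nonneg fun i _ => (hgpos j {i} (Finset.singleton_nonempty i)).le
        simp only [hw]
        split_ifs with h
        · rw [zero_mul]
          refine mul_nonpos_of_nonneg_of_nonpos (by positivity) ?_
          have h1 : 2 * g j S - C⁻¹ ≤ 4 / C := by rw [← heq]; exact h
          have h2 : C * g j S ≤ 5 / 2 := by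
            have e : C * (2 * g j S - C⁻¹) = 2 * (C * g j S) - 1 := by field_simp
            have e2 : C * (4 / C) = 4 := by field_simp
            have := mul_le_mul_of_nonneg_left h1 hC.le
            linarith
          have h3 : 2 / 5 ≤ (C * g j S)⁻¹ := by
            rw [le_inv_comm₀ (by norm_num) hCg]
            linarith
          have h4 := mul_nonneg (hxg S j) hG
          have h5 : (2 - (C * g j S)⁻¹) * x S j ≤ 8 / 5 * x S j :=
            mul_le_mul_of_nonneg_right (by linarith) hxS.le
          linarith
        · have h1 : ∑ i ∈ S ∩ Mplus g C j, mu i / lam j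
              ≤ 2 * ∑ i ∈ S ∩ Mplus g C j, g j {i} := by
            rw [Finset.mul_sum]
            exact Finset.sum_le_sum fun i hi => hprice j S hxS i (Finset.mem_inter.1 hi).1
          have h2 : ∑ i ∈ S ∩ Mplus g C j, mu i / lam j + ∑ i ∈ S \ Mplus g C j, mu i / lam j
              = ∑ i ∈ S, mu i / lam j := by
            rw [← Finset.sdiff_inter_self_left, add_comm]
            exact Finset.sum_sdiff Finset.inter_subset_left
          have h3 : 2 * g j S - C⁻¹ - 2 * ∑ i ∈ S ∩ Mplus g C j, g j {i}
              ≤ ∑ i ∈ S \ Mplus g C j, mu i / lam j := by linarith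
          refine le_trans (le_of_eq ?_) (mul_le_mul_of_nonneg_left h3
            (mul_nonneg (by positivity : (0:ℝ) ≤ 4 / C) (hxg S j)))
          field_simp
          ring
      · have : x S j = 0 := le_antisymm (not_lt.1 hxS) (hx0 S j)
        simp [hw, this]
    refine le_trans ?_ (Finset.sum_le_sum fun S _ => hterm S)
    rw [← Finset.mul_sum, Finset.sum_sub_distrib, Finset.sum_sub_distrib, htight,
      ← Finset.mul_sum, ← Finset.mul_sum]
    have e : 79 / (40 * C) = 4 / C * (79 / 160) := by field_simp; norm_num
    rw [e]
    exact mul_le_mul_of_nonneg_left (by linarith) (by positivity)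
end

section
/- Let C > 0 and let g_0, g_1, Δ_0, Δ_1 ∈ ℝ_{≥0} satisfy Δ_0 + Δ_1 ≥ 4/C, Δ_0/2 ≤ g_0 ≤ (Δ_0 + 1/C)/2, and Δ_1/2 ≤ g_1 ≤ (Δ_1 + 1/C)/2. Then (g_0·Δ_0 + g_1·Δ_1)/(g_0 + g_1) ≥ 79/(40C). (The optimization claim in the proof of Property 4 of Lemma 9; note g_0 + g_1 ≥ (Δ_0 + Δ_1)/2 ≥ 2/C > 0.) -/
lemma aux_case (c g0 g1 d0 d1 : ℝ) (hc : 0 < c) (hsum : 4 * c ≤ d0 + d1)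
    (hg0u : g0 ≤ (d0 + c) / 2) (hg1l : d1 / 2 ≤ g1) (h : d0 ≤ 79 / 40 * c) :
    0 ≤ g0 * (d0 - 79 / 40 * c) + g1 * (d1 - 79 / 40 * c) := by
  have h1 := mul_nonneg (sub_nonneg.2 hg0u) (sub_nonneg.2 h)
  have h2 : 0 ≤ (g1 - d1 / 2) * (d1 - 79 / 40 * c) :=
    mul_nonneg (by linarith) (by linarith)
  have h3 : 0 ≤ (d1 - (4 * c - d0)) * (d1 + (4 * c - d0) - 79 / 40 * c) :=
    mul_nonneg (by linarith) (by linarith)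
  have h4 := sq_nonneg (2 * c - d0 - c / 4)
  nlinarith


/-- The optimization claim in the proof of Property 4 of Lemma 9: if
`Δ₀ + Δ₁ ≥ 4/C`, `Δ₀/2 ≤ g₀ ≤ (Δ₀ + 1/C)/2` and `Δ₁/2 ≤ g₁ ≤ (Δ₁ + 1/C)/2` with all
quantities nonnegative, then `(g₀ Δ₀ + g₁ Δ₁)/(g₀ + g₁) ≥ 79/(40 C)`. -/
theorem lemma9_optimization_claim (C g0 g1 d0 d1 : ℝ) (hC : 0 < C)
    (hg0 : 0 ≤ g0) (hg1 : 0 ≤ g1) (hd0 : 0 ≤ d0) (hd1 : 0 ≤ d1)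
    (hsum : 4 / C ≤ d0 + d1)
    (hg0l : d0 / 2 ≤ g0) (hg0u : g0 ≤ (d0 + 1 / C) / 2)
    (hg1l : d1 / 2 ≤ g1) (hg1u : g1 ≤ (d1 + 1 / C) / 2) :
    79 / (40 * C) ≤ (g0 * d0 + g1 * d1) / (g0 + g1) := by
  have hc : 0 < 1 / C := by positivity
  have e1 : 4 / C = 4 * (1 / C) := by ring
  have e2 : 79 / (40 * C) = 79 / 40 * (1 / C) := by field_simp
  rw [e1] at hsum
  rw [e2]
  generalize 1 / C = c at *
  rw [le_div_iff₀ (by linarith)]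
  suffices h : 0 ≤ g0 * (d0 - 79 / 40 * c) + g1 * (d1 - 79 / 40 * c) by linarith
  by_cases h0 : d0 ≤ 79 / 40 * c
  · exact aux_case c g0 g1 d0 d1 hc hsum hg0u hg1l h0
  by_cases h1 : d1 ≤ 79 / 40 * c
  · have := aux_case c g1 g0 d1 d0 hc (by linarith) hg1u hg0l h1
    linarith
  · exact add_nonneg (mul_nonneg hg0 (by linarith)) (mul_nonneg hg1 (by linarith))
end
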